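/- Let d, m ≥ 1, r⃗ ∈ (0,∞)^m, s ∈ (1,∞], let (Ω,μ) be a σ-finite measure space, and let t⃗ ∈ (0,∞]^m with t_j > r_j for all j and 1 ≤ t < s, t < ∞, where 1/t := ∑_{j=1}^m 1/t_j. Let T be a map assigning to each m-tuple of functions in L^∞_c(ℝ^d) a measurable function on ℝ^d, such that for all f_j, g ∈ L^∞_c(ℝ^d) there exists a sparse collection 𝒮 with ∫_{ℝ^d} |T(f⃗)(x)|·|g(x)| dx ≤ C_T ∑_{Q∈𝒮} (∏_{j=1}^m ⟨f_j⟩_{r_j,Q}) ⟨g⟩_{s',Q} |Q| for some fixed C_T ≥ 0. Suppose that for all simple, bounded, boundedly supported f_j : ℝ^d × Ω → ℂ the function T̃(f⃗)(x,ω) := T(f_1(·,ω),…,f_m(·,ω))(x) is jointly measurable. Then there is a constant C depending only on d, m, r⃗, s, t⃗ such that for all such simple f⃗ and all g ∈ L^∞_c(ℝ^d) there exists a sparse collection 𝒮 with ∫_{ℝ^d} ‖T̃(f⃗)(x,·)‖_{L^t(Ω)} · |g(x)| dx ≤ C · C_T · ∑_{Q∈𝒮} (∏_{j=1}^m ⟨‖f_j(·,·)‖_{L^{t_j}(Ω)}⟩_{r_j,Q})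 ⟨g⟩_{s',Q} |Q|. -/

import Mathlib

open MeasureTheory ENNReal

noncomputable section

structure Cube (d : ℕ) where
  corner : Fin d → ℝ
  side : ℝ
  side_pos : 0 < side

namespace Cube
def set {d : ℕ} (Q : Cube d) : Set (Fin d → ℝ) :=
  {x | ∀ i, Q.corner i ≤ x i ∧ x i < Q.corner i + Q.side}
def vol {d : ℕ} (Q : Cube d) : ℝ≥0∞ := volume Q.set
def IsDyadic {d : ℕ} (Q : Cube d) : Prop :=
  ∃ (k : ℤ) (n : Fin d → ℤ), Q.side = (2:ℝ) ^ (-k) ∧ ∀ i, Q.corner i = (2:ℝ) ^ (-k) * (n i : ℝ)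
end Cube

def IsSparse {d : ℕ} (S : Set (Cube d)) : Prop :=
  ∃ E : Cube d → Set (Fin d → ℝ),
    (∀ Q ∈ S, MeasurableSet (E Q) ∧ E Q ⊆ Q.set ∧ Q.vol ≤ 2 * volume (E Q)) ∧
    S.PairwiseDisjoint E

def eNorm {α : Type*} [MeasurableSpace α] (p : ℝ≥0∞) (μ : Measure α) (F : α → ℝ≥0∞) : ℝ≥0∞ :=
  if p = ∞ then essSup F μ else (∫⁻ x, F x ^ p.toReal ∂μ) ^ (1 / p.toReal)

def nn {α : Type*} (f : α → ℂ) : α → ℝ≥0∞ := fun x => (‖f x‖₊ : ℝ≥0∞)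

def avg {d : ℕ} (r : ℝ≥0∞) (F : (Fin d → ℝ) → ℝ≥0∞) (Q : Cube d) : ℝ≥0∞ :=
  if r = ∞ then essSup F (volume.restrict Q.set)
  else ((∫⁻ x in Q.set, F x ^ r.toReal) / Q.vol) ^ (1 / r.toReal)

def maximal {d k : ℕ} (r : Fin k → ℝ≥0∞) (F : Fin k → (Fin d → ℝ) → ℝ≥0∞)
    (x : Fin d → ℝ) : ℝ≥0∞ :=
  ⨆ (Q : Cube d) (_ : x ∈ Q.set), ∏ j, avg (r j) (F j) Q

def maximalX {d k : ℕ} (r : Fin k → ℝ≥0∞) (ρ : ℝ≥0∞) (F : Fin k → (Fin d → ℝ) → ℝ≥0∞)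
    (G : (Fin d → ℝ) → ℝ≥0∞) (x : Fin d → ℝ) : ℝ≥0∞ :=
  ⨆ (Q : Cube d) (_ : x ∈ Q.set), (∏ j, avg (r j) (F j) Q) * avg ρ G Q

def wNorm {d : ℕ} (p : ℝ≥0∞) (w : (Fin d → ℝ) → ℝ) (F : (Fin d → ℝ) → ℝ≥0∞) : ℝ≥0∞ :=
  eNorm p volume (fun x => F x * ENNReal.ofReal (w x))

def aConst {d m : ℕ} (p r : Fin m → ℝ≥0∞) (s : ℝ≥0∞)
    (w : Fin m → (Fin d → ℝ) → ℝ) : ℝ≥0∞ :=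
  ⨆ Q : Cube d,
    (∏ j, avg ((r j)⁻¹ - (p j)⁻¹)⁻¹ (fun x => ENNReal.ofReal (w j x)⁻¹) Q) *
      avg ((∑ j, (p j)⁻¹) - s⁻¹)⁻¹ (fun x => ENNReal.ofReal (∏ j, w j x)) Q

def latAvg {d : ℕ} {Ω : Type*} (r : ℝ≥0∞) (f : (Fin d → ℝ) → Ω → ℂ) (Q : Cube d) (ω : Ω) : ℝ≥0∞ :=
  ((∫⁻ y in Q.set, (‖f y ω‖₊ : ℝ≥0∞) ^ r.toReal) / Q.vol) ^ (1 / r.toReal)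

def latMax {d m : ℕ} {Ω : Type*} (r : Fin m → ℝ≥0∞) (D : Finset (Cube d))
    (f : Fin m → (Fin d → ℝ) → Ω → ℂ) (x : Fin d → ℝ) (ω : Ω) : ℝ≥0∞ :=
  ⨆ Q ∈ D, ⨆ (_ : x ∈ Cube.set Q), ∏ j, latAvg (r j) (f j) Q ω

def latMaxX {d m : ℕ} {Ω : Type*} (r : Fin m → ℝ≥0∞) (ρ : ℝ≥0∞) (D : Finset (Cube d))
    (f : Fin m → (Fin d → ℝ) → Ω → ℂ) (g : (Fin d → ℝ) → Ω → ℂ)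
    (x : Fin d → ℝ) (ω : Ω) : ℝ≥0∞ :=
  ⨆ Q ∈ D, ⨆ (_ : x ∈ Cube.set Q), (∏ j, latAvg (r j) (f j) Q ω) * latAvg ρ g Q ω

def MemLinftyC {d : ℕ} (f : (Fin d → ℝ) → ℂ) : Prop :=
  Measurable f ∧ (∃ M : ℝ, ∀ x, ‖f x‖ ≤ M) ∧ Bornology.IsBounded (Function.support f)

def SimpleLinftyC {d : ℕ} (f : (Fin d → ℝ) → ℂ) : Prop :=
  Measurable f ∧ (Set.range f).Finite ∧ Bornology.IsBounded (Function.support f)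

def PairSimple {d : ℕ} {Ω : Type*} [MeasurableSpace Ω] (f : (Fin d → ℝ) → Ω → ℂ) : Prop :=
  Measurable (Function.uncurry f) ∧ (Set.range (Function.uncurry f)).Finite ∧
    ∃ B : Set (Fin d → ℝ), Bornology.IsBounded B ∧ ∀ x ∉ B, ∀ ω, f x ω = 0

def VecSimple {d : ℕ} {Ω : Type*} [MeasurableSpace Ω] (f : (Fin d → ℝ) → Ω → ℂ) : Prop :=
  ∃ (N : ℕ) (A : Fin N → Set (Fin d → ℝ)) (ξ : Fin N → Ω → ℂ),
    (∀ i, MeasurableSet (A i)) ∧ (∀ i, Bornology.IsBounded (A i)) ∧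
    (∀ i, Measurable (ξ i)) ∧ (∃ M : ℝ, ∀ i ω, ‖ξ i ω‖ ≤ M) ∧
    ∀ x ω, f x ω = ∑ i, (A i).indicator (fun _ => ξ i ω) x

lemma Cube.set_eq {d : ℕ} (Q : Cube d) :
    Q.set = Set.pi Set.univ (fun i => Set.Ico (Q.corner i) (Q.corner i + Q.side)) := by
  ext x; simp [Cube.set]

lemma Cube.meas {d : ℕ} (Q : Cube d) : MeasurableSet Q.set := by
  rw [Q.set_eq]
  exact MeasurableSet.univ_pi (fun i => measurableSet_Ico)

lemma Cube.vol_eq {d : ℕ} (Q : Cube d) : Q.vol = ENNReal.ofReal Q.side ^ d := by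
  rw [Cube.vol, Q.set_eq, Real.volume_pi_Ico]
  simp

lemma Cube.vol_ne_zero {d : ℕ} (Q : Cube d) : Q.vol ≠ 0 := by
  rw [Q.vol_eq]
  exact pow_ne_zero _ (by simpa using Q.side_pos)

lemma Cube.vol_ne_top {d : ℕ} (Q : Cube d) : Q.vol ≠ ∞ := by
  rw [Q.vol_eq]
  exact ENNReal.pow_ne_top ENNReal.ofReal_ne_top

/-- average of a nonnegative function over a cube -/
def mean {d : ℕ} (G : (Fin d → ℝ) → ℝ≥0∞) (Q : Cube d) : ℝ≥0∞ :=
  (∫⁻ y in Q.set, G y) / Q.vol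

structure DGrid (d : ℕ) where
  base : Fin d → ℝ
  len : ℝ
  pos : 0 < len

namespace DGrid
variable {d : ℕ}

def idx (D : DGrid d) (k : ℕ) (x : Fin d → ℝ) : Fin d → ℤ :=
  fun i => ⌊(x i - D.base i) / (D.len / 2 ^ k)⌋

def cell (D : DGrid d) (k : ℕ) (n : Fin d → ℤ) : Cube d :=
  ⟨fun i => D.base i + D.len / 2 ^ k * n i, D.len / 2 ^ k, by have := D.pos; positivity⟩

lemma mem_cell (D : DGrid d) (k : ℕ) (n : Fin d → ℤ) (x : Fin d → ℝ) :
    x ∈ (D.cell k n).set ↔ D.idx k x = n := by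
  have hp : 0 < D.len / 2 ^ k := by have := D.pos; positivity
  simp only [Cube.set, cell, idx, Set.mem_ofPred_eq, funext_iff, Int.floor_eq_iff]
  refine forall_congr' fun i => ?_
  rw [le_div_iff₀ hp, div_lt_iff₀ hp]
  constructor <;> rintro ⟨h1, h2⟩ <;> constructor <;> nlinarith

lemma mem_cell_self (D : DGrid d) (k : ℕ) (x : Fin d → ℝ) :
    x ∈ (D.cell k (D.idx k x)).set := (D.mem_cell _ _ _).2 rfl

lemma cell_set (D : DGrid d) (k : ℕ) (n : Fin d → ℤ) :
    (D.cell k n).set = D.idx k ⁻¹' {n} := by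
  ext x; simp [mem_cell]

lemma idx_coarse (D : DGrid d) (k : ℕ) (x : Fin d → ℝ) :
    D.idx k x = fun i => D.idx (k+1) x i / 2 := by
  funext i
  have hp := D.pos
  have h : (x i - D.base i) / (D.len / 2 ^ k)
      = ((x i - D.base i) / (D.len / 2 ^ (k+1))) / (2:ℕ) := by
    field_simp
    push_cast
    ring
  simp only [idx]
  rw [h, Int.floor_div_natCast]
  rfl

lemma idx_eq_of_le (D : DGrid d) {k l : ℕ} (h : k ≤ l) {x y : Fin d → ℝ}
    (hxy : D.idx l x = D.idx l y) : D.idx k x = D.idx k y := by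
  induction l, h using Nat.le_induction with
  | base => exact hxy
  | succ l _ ih => exact ih (by rw [D.idx_coarse l x, D.idx_coarse l y, hxy])

lemma measurable_idx (D : DGrid d) (k : ℕ) : Measurable (D.idx k) := by
  refine measurable_pi_lambda _ fun i => ?_
  exact Int.measurable_floor.comp (by fun_prop)

lemma cell_inj (D : DGrid d) {k l : ℕ} {n p : Fin d → ℤ} (h : D.cell k n = D.cell l p) :
    k = l ∧ n = p := by
  have hp := D.pos
  have h1 : D.len / 2 ^ k = D.len / 2 ^ l := congrArg Cube.side h
  have hkl : k = l := by
    have h2 : (2:ℝ) ^ k = 2 ^ l := by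
      field_simp at h1
      exact h1.symm
    exact pow_right_injective₀ (by norm_num : (0:ℝ) < 2) (by norm_num) h2
  subst hkl
  refine ⟨rfl, funext fun i => ?_⟩
  have h3 : D.base i + D.len / 2 ^ k * n i = D.base i + D.len / 2 ^ k * p i :=
    congrFun (congrArg Cube.corner h) i
  have h4 : D.len / 2 ^ k ≠ 0 := by positivity
  have h5 := mul_left_cancel₀ h4 (add_left_cancel h3)
  exact_mod_cast h5

/-- averaging operator -/
def avgOp (D : DGrid d) (k : ℕ) (G : (Fin d → ℝ) → ℝ≥0∞) (x : Fin d → ℝ) : ℝ≥0∞ :=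
  mean G (D.cell k (D.idx k x))

/-- depends only on the level-`k` cell -/
def Lev {β : Type*} (D : DGrid d) (k : ℕ) (φ : (Fin d → ℝ) → β) : Prop :=
  ∀ x y, D.idx k x = D.idx k y → φ x = φ y

lemma Lev.mono {β : Type*} {D : DGrid d} {k l : ℕ} {φ : (Fin d → ℝ) → β} (h : D.Lev k φ)
    (hkl : k ≤ l) : D.Lev l φ := fun x y hxy => h x y (D.idx_eq_of_le hkl hxy)

lemma lev_avgOp (D : DGrid d) (k : ℕ) (G) : D.Lev k (D.avgOp k G) := by
  intro x y h; simp [avgOp, h]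

lemma lev_idx (D : DGrid d) (k : ℕ) : D.Lev k (D.idx k) := fun _ _ h => h

lemma Lev.comp {β γ : Type*} {D : DGrid d} {k : ℕ} {φ : (Fin d → ℝ) → β} (h : D.Lev k φ)
    (g : β → γ) : D.Lev k (fun x => g (φ x)) := fun x y hxy => congrArg g (h x y hxy)

lemma Lev.comp₂ {β γ δ : Type*} {D : DGrid d} {k : ℕ} {φ : (Fin d → ℝ) → β}
    {ψ : (Fin d → ℝ) → γ} (h : D.Lev k φ) (h' : D.Lev k ψ)
    (g : β → γ → δ) : D.Lev k (fun x => g (φ x) (ψ x)) := fun x y hxy => by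
  simp only [h x y hxy, h' x y hxy]

lemma Lev.measurable {β : Type*} [MeasurableSpace β] {D : DGrid d} {k : ℕ}
    {φ : (Fin d → ℝ) → β} (h : D.Lev k φ) : Measurable φ := by
  by_cases hne : Nonempty β
  · have : φ = (Function.extend (D.idx k) φ (fun _ => hne.some)) ∘ D.idx k := by
      funext x
      exact (Function.FactorsThrough.extend_apply (fun a b hab => h a b hab) _ x).symm
    rw [this]
    exact (measurable_of_countable _).comp (D.measurable_idx k)
  · intro s _
    have : φ ⁻¹' s = ∅ := by
      ext x; exact (hne ⟨φ x⟩).elim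
    rw [this]; exact MeasurableSet.empty

lemma Lev.measurableSet {D : DGrid d} {k : ℕ} {φ : (Fin d → ℝ) → Prop} (h : D.Lev k φ) :
    MeasurableSet {x | φ x} := measurableSet_setOfPred.2 h.measurable

lemma lintegral_cells (D : DGrid d) (k : ℕ) (G : (Fin d → ℝ) → ℝ≥0∞) :
    ∫⁻ x, G x = ∑' n, ∫⁻ x in (D.cell k n).set, G x := by
  rw [← lintegral_iUnion (fun n => (D.cell k n).meas)]
  · have : (⋃ n, (D.cell k n).set) = Set.univ := by
      ext x; simp [mem_cell]
    rw [this, Measure.restrict_univ]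
  · intro n p hnp
    refine Set.disjoint_left.2 fun x hx hx' => hnp ?_
    rw [mem_cell] at hx hx'
    exact hx.symm.trans hx'

lemma lintegral_lev_mul_avgOp (D : DGrid d) (k : ℕ) {φ G : (Fin d → ℝ) → ℝ≥0∞}
    (hφ : D.Lev k φ) (hG : Measurable G) :
    ∫⁻ x, φ x * D.avgOp k G x = ∫⁻ x, φ x * G x := by
  rw [D.lintegral_cells k, D.lintegral_cells k]
  refine tsum_congr fun n => ?_
  by_cases hn : ∃ x₀, D.idx k x₀ = n
  · obtain ⟨x₀, hx₀⟩ := hn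
    have e1 : ∫⁻ x in (D.cell k n).set, φ x * D.avgOp k G x
        = ∫⁻ x in (D.cell k n).set, φ x₀ * mean G (D.cell k n) := by
      refine setLIntegral_congr_fun (D.cell k n).meas fun x hx => ?_
      rw [mem_cell] at hx
      simp only [avgOp, hx]
      rw [hφ x x₀ (hx.trans hx₀.symm)]
    have e2 : ∫⁻ x in (D.cell k n).set, φ x * G x
        = ∫⁻ x in (D.cell k n).set, φ x₀ * G x := by
      refine setLIntegral_congr_fun (D.cell k n).meas fun x hx => ?_
      rw [mem_cell] at hx
      rw [hφ x x₀ (hx.trans hx₀.symm)]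
    rw [e1, e2, lintegral_const_mul _ hG, setLIntegral_const, mul_assoc, mean]
    congr 1
    exact ENNReal.div_mul_cancel (D.cell k n).vol_ne_zero (D.cell k n).vol_ne_top
  · have : (D.cell k n).set = ∅ := by
      ext x; rw [mem_cell]; simp; exact fun h => hn ⟨x, h⟩
    simp [this]

end DGrid

lemma absorb {X B : ℝ≥0∞} {p : ℝ} (hp : 1 < p) (hX : X ≠ ∞) (h : X ≤ X ^ (1 - 1/p) * B) :
    X ≤ B ^ p := by
  have hp0 : 0 < p := by linarith
  by_cases h0 : X = 0
  · simp [h0]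
  have h1 : X ^ (1 - 1/p) ≠ 0 := by
    intro hh
    rw [ENNReal.rpow_eq_zero_iff] at hh
    rcases hh with hh | hh
    · exact h0 hh.1
    · exact hX hh.1
  have h2 : X ^ (1 - 1/p) ≠ ∞ := ENNReal.rpow_ne_top_of_ne_zero h0 hX
  have h3 : X ^ (1 - 1/p) * X ^ (1/p) ≤ X ^ (1 - 1/p) * B := by
    rw [← ENNReal.rpow_add _ _ h0 hX]
    simpa using h
  have h4 : X ^ (1/p) ≤ B := (ENNReal.mul_le_mul_iff_right h1 h2).1 h3
  calc X = (X ^ (1/p)) ^ p := by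
        rw [← ENNReal.rpow_mul]; simp [hp0.ne']
    _ ≤ B ^ p := ENNReal.rpow_le_rpow h4 hp0.le

lemma holder_absorb {X : Type*} [MeasurableSpace X] (ν : Measure X) {p : ℝ} (hp : 1 < p)
    {φ g : X → ℝ≥0∞} (hφ : Measurable φ) (hg : Measurable g) :
    ∫⁻ x, φ x ^ (p - 1) * g x ∂ν ≤
      (∫⁻ x, φ x ^ p ∂ν) ^ (1 - 1/p) * (∫⁻ x, g x ^ p ∂ν) ^ (1/p) := by
  have hc : (p/(p-1)).HolderConjugate p := (Real.HolderConjugate.conjExponent hp).symm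
  have := ENNReal.lintegral_mul_le_Lp_mul_Lq ν hc (hφ.pow_const (p-1)).aemeasurable
    hg.aemeasurable
  have hp1 : p - 1 ≠ 0 := by linarith
  have hp2 : p ≠ 0 := by linarith
  have e : ∀ x, (φ x ^ (p-1)) ^ (p/(p-1)) = φ x ^ p := fun x => by
    rw [← ENNReal.rpow_mul]; congr 1; field_simp
  have e2 : 1 / (p/(p-1)) = 1 - 1/p := by field_simp
  simp only [Pi.mul_apply, e, e2] at this
  exact this

/-- running maximum -/
def runMax {X : Type*} (f : ℕ → X → ℝ≥0∞) : ℕ → X → ℝ≥0∞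
  | 0 => f 0
  | (k+1) => fun x => max (runMax f k x) (f (k+1) x)

lemma le_runMax {X : Type*} (f : ℕ → X → ℝ≥0∞) (k : ℕ) (x : X) : f k x ≤ runMax f k x := by
  cases k with
  | zero => exact le_rfl
  | succ k => exact le_max_right _ _

lemma runMax_mono {X : Type*} (f : ℕ → X → ℝ≥0∞) : Monotone (runMax f) :=
  monotone_nat_of_le_succ fun _ _ => le_max_left _ _

lemma measurable_runMax {X : Type*} [MeasurableSpace X] {f : ℕ → X → ℝ≥0∞}
    (hf : ∀ k, Measurable (f k)) (k : ℕ) : Measurable (runMax f k) := by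
  induction k with
  | zero => exact hf 0
  | succ k ih => exact ih.max (hf (k+1))

lemma doob_pt {p : ℝ} (hp : 1 < p) (a b : ℝ≥0∞) :
    max a b ^ p + ENNReal.ofReal (p/(p-1)) * (a ^ (p-1) * b) ≤
      a ^ p + ENNReal.ofReal (p/(p-1)) * (max a b ^ (p-1) * b) := by
  have hp1 : 0 < p - 1 := by linarith
  have hp0 : 0 < p := by linarith
  rcases le_total b a with h | h
  · rw [max_eq_left h]
  rw [max_eq_right h]
  have hc : (p/(p-1)).HolderConjugate p := (Real.HolderConjugate.conjExponent hp).symm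
  have hy := ENNReal.young_inequality (a ^ (p-1)) b hc
  have e : (a ^ (p-1)) ^ (p/(p-1)) = a ^ p := by
    rw [← ENNReal.rpow_mul]; congr 1; field_simp
  have e2 : b ^ (p-1) * b = b ^ p := by
    nth_rewrite 2 [← ENNReal.rpow_one b]
    rw [← ENNReal.rpow_add_of_nonneg _ _ hp1.le zero_le_one]; simp
  rw [e] at hy
  rw [e2]
  have hq0 : ENNReal.ofReal (p/(p-1)) ≠ 0 := by simp; positivity
  calc b ^ p + ENNReal.ofReal (p/(p-1)) * (a ^ (p-1) * b)
      ≤ b ^ p + ENNReal.ofReal (p/(p-1)) *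
          (a ^ p / ENNReal.ofReal (p/(p-1)) + b ^ p / ENNReal.ofReal p) := by gcongr
    _ = a ^ p + ENNReal.ofReal (p/(p-1)) * b ^ p := by
        rw [mul_add, ENNReal.mul_div_cancel hq0 ENNReal.ofReal_ne_top]
        have e3 : ENNReal.ofReal (p/(p-1)) * (b ^ p / ENNReal.ofReal p)
            = ENNReal.ofReal (1/(p-1)) * b ^ p := by
          rw [ENNReal.div_eq_inv_mul, ← mul_assoc, ← ENNReal.ofReal_inv_of_pos hp0,
            ← ENNReal.ofReal_mul (by positivity)]
          congr 2; field_simp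
        have e4 : ENNReal.ofReal (p/(p-1)) = 1 + ENNReal.ofReal (1/(p-1)) := by
          rw [← ENNReal.ofReal_one, ← ENNReal.ofReal_add zero_le_one (by positivity)]
          congr 1; field_simp; ring
        rw [e3, e4]; ring

lemma doob {X : Type*} [MeasurableSpace X] (ν : Measure X) {p : ℝ} (hp : 1 < p)
    (f : ℕ → X → ℝ≥0∞) (hf : ∀ k, Measurable (f k)) (K : ℝ≥0∞)
    (hK : ∀ k, ∫⁻ x, f k x ^ p ∂ν ≤ K)
    (horth : ∀ k, ∫⁻ x, runMax f k x ^ (p-1) * f (k+1) x ∂ν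
      = ∫⁻ x, runMax f k x ^ (p-1) * f k x ∂ν) :
    ∫⁻ x, (⨆ k, f k x) ^ p ∂ν ≤ ENNReal.ofReal (p/(p-1)) ^ p * K := by
  have hp1 : 0 < p - 1 := by linarith
  have hp0 : 0 < p := by linarith
  have hq0 : ENNReal.ofReal (p/(p-1)) ≠ 0 := by simp; positivity
  by_cases hKt : K = ∞
  · rw [hKt, ENNReal.mul_top]
    · exact le_top
    · simp [hq0]
  have hm := measurable_runMax hf
  set q := ENNReal.ofReal (p/(p-1)) with hq
  have hXfin : ∀ k, ∫⁻ x, runMax f k x ^ p ∂ν ≠ ∞ := by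
    intro k
    induction k with
    | zero => exact ((hK 0).trans_lt (lt_top_iff_ne_top.2 hKt)).ne
    | succ k ih =>
      have : ∫⁻ x, runMax f (k+1) x ^ p ∂ν ≤
          ∫⁻ x, runMax f k x ^ p ∂ν + ∫⁻ x, f (k+1) x ^ p ∂ν := by
        rw [← lintegral_add_left ((hm k).pow_const p)]
        refine lintegral_mono fun x => ?_
        simp only [runMax]
        rcases le_total (runMax f k x) (f (k+1) x) with h | h
        · rw [max_eq_right h]; exact le_add_self
        · rw [max_eq_left h]; exact le_self_add
      refine (this.trans_lt ?_).ne
      exact ENNReal.add_lt_top.2 ⟨lt_top_iff_ne_top.2 ih,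
        (hK _).trans_lt (lt_top_iff_ne_top.2 hKt)⟩
  have hmul : ∀ a : ℝ≥0∞, a ^ (p-1) * a = a ^ p := fun a => by
    nth_rewrite 2 [← ENNReal.rpow_one a]
    rw [← ENNReal.rpow_add_of_nonneg _ _ hp1.le zero_le_one]; simp
  have hYfin : ∀ k, ∫⁻ x, runMax f k x ^ (p-1) * f k x ∂ν ≠ ∞ := by
    intro k
    refine ((lintegral_mono fun x => ?_).trans_lt (lt_top_iff_ne_top.2 (hXfin k))).ne
    rw [← hmul]
    gcongr
    exact le_runMax f k x
  have hmm : ∀ a b, Measurable fun x => runMax f a x ^ (p-1) * f b x := fun a b =>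
    ((hm a).pow_const _).mul (hf b)
  have hXY : ∀ k, ∫⁻ x, runMax f k x ^ p ∂ν ≤ q * ∫⁻ x, runMax f k x ^ (p-1) * f k x ∂ν := by
    intro k
    induction k with
    | zero =>
      simp only [runMax, hmul]
      have : 1 ≤ q := by
        rw [hq, ENNReal.one_le_ofReal, le_div_iff₀ hp1]; linarith
      exact le_mul_of_one_le_left' this
    | succ k ih =>
      have h1 : ∫⁻ x, runMax f (k+1) x ^ p ∂ν + q * ∫⁻ x, runMax f k x ^ (p-1) * f (k+1) x ∂ν
          ≤ ∫⁻ x, runMax f k x ^ p ∂ν + q * ∫⁻ x, runMax f (k+1) x ^ (p-1) * f (k+1) x ∂ν := by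
        rw [← lintegral_const_mul _ (hmm k (k+1)), ← lintegral_const_mul _ (hmm (k+1) (k+1)),
          ← lintegral_add_left ((hm _).pow_const p), ← lintegral_add_left ((hm _).pow_const p)]
        exact lintegral_mono fun x => doob_pt hp _ _
      rw [horth] at h1
      have h2 := h1.trans (add_le_add_left ih _)
      rw [add_comm] at h2
      exact (ENNReal.add_le_add_iff_left
        (ENNReal.mul_ne_top ENNReal.ofReal_ne_top (hYfin k))).1 h2
  have hfin : ∀ k, ∫⁻ x, runMax f k x ^ p ∂ν ≤ q ^ p * K := by
    intro k
    have h1 : ∫⁻ x, runMax f k x ^ p ∂ν ≤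
        (∫⁻ x, runMax f k x ^ p ∂ν) ^ (1 - 1/p) * (q * K ^ (1/p)) := by
      refine (hXY k).trans ?_
      rw [mul_left_comm]
      gcongr
      refine (holder_absorb ν hp (hm k) (hf k)).trans ?_
      gcongr
      exact hK k
    refine (absorb hp (hXfin k) h1).trans ?_
    rw [ENNReal.mul_rpow_of_nonneg _ _ hp0.le, ← ENNReal.rpow_mul]
    simp [hp0.ne']
  have hle : ∀ x, (⨆ k, f k x) ^ p ≤ ⨆ k, runMax f k x ^ p := by
    intro x
    have : (⨆ k, f k x) ≤ (⨆ k, runMax f k x ^ p) ^ (1/p) := by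
      refine iSup_le fun k => ?_
      refine (le_runMax f k x).trans ?_
      have : runMax f k x = (runMax f k x ^ p) ^ (1/p) := by
        rw [← ENNReal.rpow_mul]; simp [hp0.ne']
      rw [this]
      gcongr
      exact le_iSup (fun k => runMax f k x ^ p) k
    calc _ ≤ ((⨆ k, runMax f k x ^ p) ^ (1/p)) ^ p := by gcongr
      _ = _ := by rw [← ENNReal.rpow_mul]; simp [hp0.ne']
  refine (lintegral_mono hle).trans ?_
  rw [lintegral_iSup (fun k => (hm k).pow_const p)]
  · exact iSup_le hfin
  · intro i j hij x
    exact ENNReal.rpow_le_rpow (runMax_mono f hij x) hp0.le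

lemma minkowski {X Ω : Type*} [MeasurableSpace X] [MeasurableSpace Ω] (ν : Measure X)
    [SFinite ν] (μ : Measure Ω) [SigmaFinite μ] {p : ℝ} (hp : 1 < p) (G : X → Ω → ℝ≥0∞)
    (hG : Measurable (Function.uncurry G)) (h : X → ℝ≥0∞)
    (hh : ∀ y, ∫⁻ ω, G y ω ^ p ∂μ ≤ h y ^ p) :
    ∫⁻ ω, (∫⁻ y, G y ω ∂ν) ^ p ∂μ ≤ (∫⁻ y, h y ∂ν) ^ p := by
  have hp1 : 0 < p - 1 := by linarith
  have hp0 : 0 < p := by linarith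
  set φ : Ω → ℝ≥0∞ := fun ω => ∫⁻ y, G y ω ∂ν with hφ
  have hφm : Measurable φ := hG.lintegral_prod_left'
  let ψ : ℕ → Ω → ℝ≥0∞ := fun n => (spanningSets μ n).indicator (fun ω => min (φ ω) n)
  have hψm : ∀ n, Measurable (ψ n) := fun n =>
    (hφm.min measurable_const).indicator (measurableSet_spanningSets μ n)
  have hψmono : Monotone ψ := by
    intro i j hij ω
    simp only [ψ]
    refine (Set.indicator_le_indicator_of_subset (monotone_spanningSets μ hij)
      (fun _ => zero_le) ω).trans (Set.indicator_le_indicator ?_)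
    gcongr
  have hψle : ∀ n ω, ψ n ω ≤ φ ω := fun n ω =>
    (Set.indicator_le_self _ _ ω).trans (min_le_left _ _)
  have hψsup : ∀ ω, φ ω ^ p ≤ ⨆ n, ψ n ω ^ p := by
    intro ω
    have : φ ω ≤ ⨆ n, ψ n ω := by
      refine le_of_forall_lt fun b hb => ?_
      obtain ⟨N, hN⟩ : ∃ N, ω ∈ spanningSets μ N := by
        have : ω ∈ ⋃ i, spanningSets μ i := by rw [iUnion_spanningSets]; trivial
        exact Set.mem_iUnion.1 this
      obtain ⟨M, hM⟩ := ENNReal.exists_nat_gt hb.ne_top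
      refine lt_of_lt_of_le ?_ (le_iSup (fun n => ψ n ω) (max N M))
      simp only [ψ]
      rw [Set.indicator_of_mem (monotone_spanningSets μ (le_max_left N M) hN)]
      exact lt_min hb (hM.trans_le (by exact_mod_cast le_max_right N M))
    calc φ ω ^ p ≤ (⨆ n, ψ n ω) ^ p := by gcongr
      _ = _ := (ENNReal.orderIsoRpow p hp0).map_iSup _
  have hfin : ∀ n, ∫⁻ ω, ψ n ω ^ p ∂μ ≠ ∞ := by
    intro n
    have : ∫⁻ ω, ψ n ω ^ p ∂μ ≤ ∫⁻ ω in spanningSets μ n, (n:ℝ≥0∞) ^ p ∂μ := by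
      rw [← lintegral_indicator (measurableSet_spanningSets μ n)]
      refine lintegral_mono fun ω => ?_
      simp only [ψ, Set.indicator]
      split_ifs
      · gcongr; exact min_le_right _ _
      · simp [hp0]
    refine (this.trans_lt ?_).ne
    rw [setLIntegral_const]
    exact ENNReal.mul_lt_top (ENNReal.rpow_lt_top_of_nonneg hp0.le (by simp))
      (measure_spanningSets_lt_top μ n)
  have hmul : ∀ a : ℝ≥0∞, a ^ (p-1) * a = a ^ p := fun a => by
    nth_rewrite 2 [← ENNReal.rpow_one a]
    rw [← ENNReal.rpow_add_of_nonneg _ _ hp1.le zero_le_one]; simp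
  have key : ∀ n, ∫⁻ ω, ψ n ω ^ p ∂μ ≤ (∫⁻ y, h y ∂ν) ^ p := by
    intro n
    refine absorb hp (hfin n) ?_
    have hX1 : (∫⁻ ω, ψ n ω ^ p ∂μ) ^ (1 - 1/p) ≠ ∞ :=
      ENNReal.rpow_ne_top_of_nonneg (by rw [sub_nonneg, div_le_one hp0]; exact hp.le) (hfin n)
    calc ∫⁻ ω, ψ n ω ^ p ∂μ ≤ ∫⁻ ω, ψ n ω ^ (p-1) * φ ω ∂μ := by
          refine lintegral_mono fun ω => ?_
          rw [← hmul]
          gcongr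
          exact hψle n ω
      _ = ∫⁻ ω, ∫⁻ y, ψ n ω ^ (p-1) * G y ω ∂ν ∂μ := by
          refine lintegral_congr fun ω => ?_
          exact (lintegral_const_mul (f := fun y => G y ω) _
            (hG.comp measurable_prodMk_right)).symm
      _ = ∫⁻ y, ∫⁻ ω, ψ n ω ^ (p-1) * G y ω ∂μ ∂ν := by
          refine lintegral_lintegral_swap ?_
          refine Measurable.aemeasurable ?_
          exact (((hψm n).comp measurable_fst).pow_const _).mul (hG.comp measurable_swap)
      _ ≤ ∫⁻ y, (∫⁻ ω, ψ n ω ^ p ∂μ) ^ (1 - 1/p) * h y ∂ν := by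
          refine lintegral_mono fun y => ?_
          refine (holder_absorb μ hp (hψm n) (hG.comp measurable_prodMk_left)).trans ?_
          gcongr
          calc (∫⁻ ω, (G y ω) ^ p ∂μ) ^ (1/p) ≤ (h y ^ p) ^ (1/p) := by
                gcongr; exact hh y
            _ = h y := by rw [← ENNReal.rpow_mul]; simp [hp0.ne']
      _ = _ := lintegral_const_mul' _ _ hX1
  refine (lintegral_mono hψsup).trans ?_
  rw [lintegral_iSup (fun n => (hψm n).pow_const p)]
  · exact iSup_le key
  · intro i j hij ω
    exact ENNReal.rpow_le_rpow (hψmono hij ω) hp0.le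

namespace DGrid
variable {d : ℕ} {ι : Type*}

open Classical in
/-- level of the principal ancestor of the level-`k` cell containing `x` -/
def prin (D : DGrid d) (h : ι → (Fin d → ℝ) → ℝ≥0∞) (Λ : ℝ≥0∞) : ℕ → (Fin d → ℝ) → ℕ
  | 0 => fun _ => 0
  | (k+1) => fun x =>
      if ∃ j, Λ * D.avgOp (prin D h Λ k x) (h j) x < D.avgOp (k+1) (h j) x then k+1
      else prin D h Λ k x

variable (D : DGrid d) (h : ι → (Fin d → ℝ) → ℝ≥0∞) (Λ : ℝ≥0∞)

lemma prin_le (k : ℕ) (x) : D.prin h Λ k x ≤ k := by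
  induction k with
  | zero => exact le_rfl
  | succ k ih =>
    simp only [prin]
    split_ifs
    · exact le_rfl
    · omega

lemma prin_lev (k : ℕ) : D.Lev k (D.prin h Λ k) := by
  induction k with
  | zero => intro x y _; rfl
  | succ k ih =>
    intro x y hxy
    have h1 := ih x y (D.idx_eq_of_le (Nat.le_succ k) hxy)
    simp only [prin]
    rw [h1]
    have h2 : ∀ j, D.avgOp (D.prin h Λ k y) (h j) x = D.avgOp (D.prin h Λ k y) (h j) y := fun j =>
      D.lev_avgOp _ _ x y (D.idx_eq_of_le ((D.prin_le h Λ k y).trans (Nat.le_succ k)) hxy)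
    have h3 : ∀ j, D.avgOp (k+1) (h j) x = D.avgOp (k+1) (h j) y := fun j =>
      D.lev_avgOp _ _ x y hxy
    have h4 : (∃ j, Λ * D.avgOp (D.prin h Λ k y) (h j) x < D.avgOp (k+1) (h j) x) ↔
        ∃ j, Λ * D.avgOp (D.prin h Λ k y) (h j) y < D.avgOp (k+1) (h j) y :=
      exists_congr fun j => by rw [h2 j, h3 j]
    classical exact if_congr h4 rfl rfl

lemma prin_succ (k : ℕ) (x) :
    D.prin h Λ (k+1) x = k+1 ∨ D.prin h Λ (k+1) x = D.prin h Λ k x := by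
  simp only [prin]; split_ifs <;> simp

lemma prin_back {q i : ℕ} (hqi : q ≤ i) {x} (hx : D.prin h Λ (i+1) x = q) :
    D.prin h Λ i x = q := by
  rcases D.prin_succ h Λ i x with h1 | h1
  · omega
  · omega

lemma prin_prin (k : ℕ) (x) : D.prin h Λ (D.prin h Λ k x) x = D.prin h Λ k x := by
  induction k with
  | zero => rfl
  | succ k ih =>
    rcases D.prin_succ h Λ k x with h1 | h1
    · rw [h1, h1]
    · rw [h1, ih]

lemma avgOp_le_of_prin (hΛ : 1 ≤ Λ) {q k : ℕ} {x} (hx : D.prin h Λ k x = q) (j : ι) :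
    D.avgOp k (h j) x ≤ Λ * D.avgOp q (h j) x := by
  by_cases hk : q = k
  · rw [hk]; exact le_mul_of_one_le_left' hΛ
  have := D.prin_le h Λ k x
  obtain ⟨i, rfl⟩ : ∃ i, k = i + 1 := ⟨k - 1, by omega⟩
  simp only [prin] at hx
  split_ifs at hx with hc
  · omega
  · rw [← hx]
    push Not at hc
    exact hc j

lemma cell_subset {q i : ℕ} (hqi : q ≤ i) (x : Fin d → ℝ) :
    (D.cell i (D.idx i x)).set ⊆ (D.cell q (D.idx q x)).set := by
  intro y hy
  rw [mem_cell] at hy ⊢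
  exact D.idx_eq_of_le hqi hy

lemma weak_aux (G : (Fin d → ℝ) → ℝ≥0∞) (hG : Measurable G) (q : ℕ) (n : Fin d → ℤ)
    (lam : ℝ≥0∞) :
    lam * volume {x | x ∈ (D.cell q n).set ∧ ∃ i, q ≤ i ∧ lam < D.avgOp i G x} ≤
      ∫⁻ x in (D.cell q n).set, G x := by
  let P : ℕ → (Fin d → ℝ) → Prop := fun i x => (D.idx q x = n ∧ q ≤ i) ∧
    lam < D.avgOp i G x ∧ ∀ l, l < i → q ≤ l → ¬ lam < D.avgOp l G x
  let W : ℕ → Set (Fin d → ℝ) := fun i => {x | P i x}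
  have hlev : ∀ i, D.Lev i (P i) := by
    intro i x y hxy
    by_cases hqi : q ≤ i
    · have h1 := D.idx_eq_of_le hqi hxy
      have h2 : ∀ l, l ≤ i → D.avgOp l G x = D.avgOp l G y := fun l hl =>
        D.lev_avgOp _ _ x y (D.idx_eq_of_le hl hxy)
      simp only [P, h1, h2 i le_rfl, eq_iff_iff]
      refine and_congr_right fun _ => and_congr_right fun _ => forall_congr' fun l =>
        forall_congr' fun hl => ?_
      rw [h2 l hl.le]
    · simp [P, hqi]
  have hWm : ∀ i, MeasurableSet (W i) := fun i => (hlev i).measurableSet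
  have hWd : Pairwise (Function.onFun Disjoint W) := by
    intro i l hil
    refine Set.disjoint_left.2 fun x hx hx' => ?_
    obtain ⟨⟨_, a1⟩, a2, a3⟩ : P i x := hx
    obtain ⟨⟨_, b1⟩, b2, b3⟩ : P l x := hx'
    rcases lt_or_gt_of_ne hil with hlt | hlt
    · exact b3 i hlt a1 a2
    · exact a3 l hlt b1 b2
  have hWU : {x | x ∈ (D.cell q n).set ∧ ∃ i, q ≤ i ∧ lam < D.avgOp i G x} ⊆ ⋃ i, W i := by
    classical
    rintro x ⟨hx, hi⟩
    rw [mem_cell] at hx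
    refine Set.mem_iUnion.2 ⟨Nat.find hi, ⟨hx, (Nat.find_spec hi).1⟩, (Nat.find_spec hi).2, ?_⟩
    intro l hl hql hc
    exact Nat.find_min hi hl ⟨hql, hc⟩
  have hWQ : (⋃ i, W i) ⊆ (D.cell q n).set := by
    intro x hx
    obtain ⟨i, hi⟩ := Set.mem_iUnion.1 hx
    have hi' : P i x := hi
    exact (D.mem_cell _ _ _).2 hi'.1.1
  have hWi : ∀ i, lam * volume (W i) ≤ ∫⁻ x in W i, G x := by
    intro i
    have hl2 : D.Lev i ((W i).indicator (fun _ => (1:ℝ≥0∞))) := by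
      intro x y hxy
      have := hlev i x y hxy
      by_cases hx : x ∈ W i
      · have hy : y ∈ W i := by
          change P i y; rw [← this]; exact hx
        simp [hx, hy]
      · have hy : y ∉ W i := by
          change ¬ P i y; rw [← this]; exact hx
        simp [hx, hy]
    have e := D.lintegral_lev_mul_avgOp i hl2 hG
    have e2 : ∫⁻ x, (W i).indicator (fun _ => (1:ℝ≥0∞)) x * G x = ∫⁻ x in W i, G x := by
      rw [← lintegral_indicator (hWm i)]
      refine lintegral_congr fun x => ?_
      by_cases hx : x ∈ W i <;> simp [hx]
    rw [← e2, ← e]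
    have e3 : lam * volume (W i) = ∫⁻ x, (W i).indicator (fun _ => lam) x := by
      rw [lintegral_indicator (hWm i), setLIntegral_const]
    rw [e3]
    refine lintegral_mono fun x => ?_
    by_cases hx : x ∈ W i
    · have hx' : P i x := hx
      simpa [hx] using hx'.2.1.le
    · simp [hx]
  calc lam * volume {x | x ∈ (D.cell q n).set ∧ ∃ i, q ≤ i ∧ lam < D.avgOp i G x}
      ≤ lam * volume (⋃ i, W i) := by gcongr
    _ ≤ lam * ∑' i, volume (W i) := by gcongr; exact measure_iUnion_le _
    _ = ∑' i, lam * volume (W i) := ENNReal.tsum_mul_left.symm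
    _ ≤ ∑' i, ∫⁻ x in W i, G x := ENNReal.tsum_le_tsum hWi
    _ = ∫⁻ x in ⋃ i, W i, G x := (lintegral_iUnion hWm hWd G).symm
    _ ≤ _ := lintegral_mono_set hWQ

lemma weak_type (G : (Fin d → ℝ) → ℝ≥0∞) (hG : Measurable G) (q : ℕ) (n : Fin d → ℤ)
    (hΛ : Λ ≠ 0) (hΛ' : Λ ≠ ∞) :
    volume {x | x ∈ (D.cell q n).set ∧ ∃ i, q ≤ i ∧ Λ * D.avgOp q G x < D.avgOp i G x} ≤
      (D.cell q n).vol / Λ := by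
  set a := mean G (D.cell q n) with ha
  have hset : {x | x ∈ (D.cell q n).set ∧ ∃ i, q ≤ i ∧ Λ * D.avgOp q G x < D.avgOp i G x} =
      {x | x ∈ (D.cell q n).set ∧ ∃ i, q ≤ i ∧ Λ * a < D.avgOp i G x} := by
    ext x
    refine and_congr_right fun hx => ?_
    rw [mem_cell] at hx
    simp only [ha, avgOp, hx]
  rw [hset]
  by_cases h0 : a = 0
  · have : {x | x ∈ (D.cell q n).set ∧ ∃ i, q ≤ i ∧ Λ * a < D.avgOp i G x} = ∅ := by
      ext x
      simp only [Set.mem_ofPred_eq, Set.mem_empty_iff_false, iff_false, not_and, not_exists]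
      intro hx i hi
      rw [mem_cell] at hx
      rw [h0, mul_zero, not_lt, nonpos_iff_eq_zero]
      have h1 : ∫⁻ y in (D.cell q n).set, G y = 0 := by
        rcases ENNReal.div_eq_zero_iff.1 h0 with h1 | h1
        · exact h1
        · exact absurd h1 (D.cell q n).vol_ne_top
      have h2 : ∫⁻ y in (D.cell i (D.idx i x)).set, G y = 0 := by
        refine le_antisymm ?_ zero_le
        rw [← h1, ← hx]
        exact lintegral_mono_set (D.cell_subset hi x)
      simp [avgOp, mean, h2]
    rw [this]; simp
  by_cases ht : a = ∞
  · have : {x | x ∈ (D.cell q n).set ∧ ∃ i, q ≤ i ∧ Λ * a < D.avgOp i G x} = ∅ := by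
      ext x
      simp [ht, hΛ]
    rw [this]; simp
  have h1 := D.weak_aux G hG q n (Λ * a)
  have h2 : ∫⁻ x in (D.cell q n).set, G x = a * (D.cell q n).vol :=
    (ENNReal.div_mul_cancel (D.cell q n).vol_ne_zero (D.cell q n).vol_ne_top).symm
  rw [h2, mul_comm Λ a, mul_assoc, ENNReal.mul_le_mul_iff_right h0 ht] at h1
  rw [ENNReal.le_div_iff_mul_le (Or.inl hΛ) (Or.inl hΛ'), mul_comm]
  rwa [mul_comm a Λ] at h1

/-- the collection of principal cubes -/
def prinSet : Set (Cube d) :=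
  {Q | ∃ k n, (∀ x, D.idx k x = n → D.prin h Λ k x = k) ∧ Q = D.cell k n}

lemma cell_nonempty (k : ℕ) (n : Fin d → ℤ) : ∃ x, D.idx k x = n := by
  refine ⟨(D.cell k n).corner, (D.mem_cell _ _ _).1 fun i => ⟨le_rfl, ?_⟩⟩
  linarith [(D.cell k n).side_pos]

lemma isSparse_prinSet [Fintype ι] [Nonempty ι] (hm : ∀ j, Measurable (h j)) :
    IsSparse (D.prinSet h (2 * Fintype.card ι)) := by
  set Λ : ℝ≥0∞ := 2 * Fintype.card ι with hΛdef
  have hcard : (Fintype.card ι : ℝ≥0∞) ≠ 0 := by simp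
  have hΛ0 : Λ ≠ 0 := by simp [hΛdef]
  have hΛt : Λ ≠ ∞ := by simp [hΛdef, ENNReal.mul_eq_top]
  let E : Cube d → Set (Fin d → ℝ) := fun Q =>
    ⋃ k, {x | Q = D.cell k (D.idx k x) ∧ ∀ i, k ≤ i → D.prin h Λ i x = k}
  have hEm : ∀ Q, MeasurableSet (E Q) := by
    intro Q
    refine MeasurableSet.iUnion fun k => ?_
    have : {x | Q = D.cell k (D.idx k x) ∧ ∀ i, k ≤ i → D.prin h Λ i x = k} =
      {x | Q = D.cell k (D.idx k x)} ∩ ⋂ i, {x | k ≤ i → D.prin h Λ i x = k} := by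
      ext x; simp
    rw [this]
    refine MeasurableSet.inter (D.lev_idx k |>.comp (fun n => Q = D.cell k n)).measurableSet ?_
    exact MeasurableSet.iInter fun i =>
      ((D.prin_lev h Λ i).comp (fun n => k ≤ i → n = k)).measurableSet
  refine ⟨E, ?_, ?_⟩
  · rintro Q ⟨q, n, hq, rfl⟩
    refine ⟨hEm _, ?_, ?_⟩
    · intro x hx
      obtain ⟨k, hk, _⟩ := Set.mem_iUnion.1 hx
      rw [hk]; exact D.mem_cell_self k x
    · have hsub : (D.cell q n).set ⊆ E (D.cell q n) ∪
          ⋃ j, {x | x ∈ (D.cell q n).set ∧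
            ∃ i, q ≤ i ∧ Λ * D.avgOp q (h j) x < D.avgOp i (h j) x} := by
        intro x hx
        by_cases hall : ∀ i, q ≤ i → D.prin h Λ i x = q
        · left
          refine Set.mem_iUnion.2 ⟨q, ?_, hall⟩
          rw [(D.mem_cell _ _ _).1 hx]
        · right
          classical
          push Not at hall
          have hs := Nat.find_spec hall
          have hmin := fun l => Nat.find_min hall (m := l)
          set i := Nat.find hall with hi
          have hqx : D.prin h Λ q x = q := hq x ((D.mem_cell _ _ _).1 hx)
          have hne : i ≠ q := by
            intro hh; rw [hh] at hs; exact hs.2 hqx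
          obtain ⟨l, hl⟩ : ∃ l, i = l + 1 := ⟨i - 1, by have := hs.1; omega⟩
          have hl2 : D.prin h Λ l x = q := by
            by_contra hcon
            exact hmin l (by omega) ⟨by have := hs.1; omega, hcon⟩
          have hs2 := hs.2
          rw [hl] at hs2
          simp only [prin] at hs2
          split_ifs at hs2 with hc
          · obtain ⟨j, hj⟩ := hc
            rw [hl2] at hj
            exact Set.mem_iUnion.2 ⟨j, hx, l+1, by have := hs.1; omega, hj⟩
          · exact absurd hl2 hs2
      have hbad : volume (⋃ j, {x | x ∈ (D.cell q n).set ∧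
            ∃ i, q ≤ i ∧ Λ * D.avgOp q (h j) x < D.avgOp i (h j) x}) ≤ (D.cell q n).vol / 2 := by
        refine (measure_iUnion_fintype_le volume _).trans ?_
        refine (Finset.sum_le_sum fun j _ => D.weak_type Λ (h j) (hm j) q n hΛ0 hΛt).trans ?_
        rw [Finset.sum_const, nsmul_eq_mul, hΛdef, Finset.card_univ]
        rw [ENNReal.div_eq_inv_mul, ENNReal.mul_inv (by simp) (by simp), mul_comm (2:ℝ≥0∞)⁻¹,
          ← mul_assoc, ← mul_assoc, ENNReal.mul_inv_cancel hcard (by simp), one_mul,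
          ENNReal.div_eq_inv_mul]
      have h1 : (D.cell q n).vol ≤ volume (E (D.cell q n)) + (D.cell q n).vol / 2 :=
        (measure_mono hsub).trans ((measure_union_le _ _).trans (by gcongr))
      have h2 : (D.cell q n).vol / 2 + (D.cell q n).vol / 2 ≤
          volume (E (D.cell q n)) + (D.cell q n).vol / 2 := by rwa [ENNReal.add_halves]
      have h3 : (D.cell q n).vol / 2 ≠ ∞ :=
        ENNReal.div_ne_top (D.cell q n).vol_ne_top (by simp)
      have h4 := (ENNReal.add_le_add_iff_right h3).1 h2
      calc (D.cell q n).vol = 2 * ((D.cell q n).vol / 2) := by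
            rw [ENNReal.mul_div_cancel (by simp) (by simp)]
        _ ≤ _ := by gcongr
  · intro Q _ Q' _ hne
    refine Set.disjoint_left.2 fun x hx hx' => hne ?_
    obtain ⟨k, hk, hk2⟩ := Set.mem_iUnion.1 hx
    obtain ⟨l, hl, hl2⟩ := Set.mem_iUnion.1 hx'
    have : k = l := by
      rw [← hk2 (max k l) (le_max_left _ _), hl2 (max k l) (le_max_right _ _)]
    subst this
    rw [hk, hl]

end DGrid

namespace DGrid
variable {d : ℕ} {ι Ω : Type*} [MeasurableSpace Ω]

open Classical in
/-- stopped averages -/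
def stp (D : DGrid d) (π : ℕ → (Fin d → ℝ) → ℕ) (q : ℕ) (G : (Fin d → ℝ) → ℝ≥0∞) :
    ℕ → (Fin d → ℝ) → ℝ≥0∞
  | 0 => D.avgOp q G
  | (i+1) => fun x => if π (q+i) x = q then D.avgOp (q+i+1) G x else stp D π q G i x

variable (D : DGrid d) (h : ι → (Fin d → ℝ) → ℝ≥0∞) (Λ : ℝ≥0∞)

lemma stp_lev {π : ℕ → (Fin d → ℝ) → ℕ} (hπ : ∀ k, D.Lev k (π k)) (q : ℕ) (G) (i : ℕ) :
    D.Lev (q+i) (D.stp π q G i) := by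
  induction i with
  | zero => exact D.lev_avgOp q G
  | succ i ih =>
    intro x y hxy
    have hxy' := D.idx_eq_of_le (Nat.le_succ (q+i)) hxy
    simp only [stp]
    rw [hπ (q+i) x y hxy', ih x y hxy', D.lev_avgOp (q+i+1) G x y hxy]

lemma measurable_avgOp_prod (k : ℕ) (G : (Fin d → ℝ) → Ω → ℝ≥0∞)
    (hG : Measurable (Function.uncurry G)) :
    Measurable (fun z : (Fin d → ℝ) × Ω => D.avgOp k (fun y => G y z.2) z.1) := by
  have h1 : Measurable (fun w : (Fin d → ℤ) × Ω => mean (fun y => G y w.2) (D.cell k w.1)) := by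
    refine measurable_from_prod_countable_right fun n => ?_
    have h2 : Measurable fun ω => ∫⁻ y in (D.cell k n).set, G y ω := hG.lintegral_prod_left'
    simp only [mean]
    exact h2.div_const (D.cell k n).vol
  have h3 : Measurable (fun z : (Fin d → ℝ) × Ω => (D.idx k z.1, z.2)) :=
    ((D.measurable_idx k).comp measurable_fst).prodMk measurable_snd
  have h4 := h1.comp h3
  exact h4

lemma measurable_stp {π : ℕ → (Fin d → ℝ) → ℕ} (hπ : ∀ k, D.Lev k (π k)) (q : ℕ)
    (G : (Fin d → ℝ) → Ω → ℝ≥0∞) (hG : Measurable (Function.uncurry G)) (i : ℕ) :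
    Measurable (fun z : (Fin d → ℝ) × Ω => D.stp π q (fun y => G y z.2) i z.1) := by
  induction i with
  | zero => exact D.measurable_avgOp_prod q G hG
  | succ i ih =>
    simp only [stp]
    refine Measurable.ite ?_ (D.measurable_avgOp_prod _ G hG) ih
    exact measurable_fst ((hπ (q+i)).comp (fun n => n = q)).measurableSet

lemma stp_of_prin (q : ℕ) (G) (i : ℕ) (x) (hx : D.prin h Λ (q+i) x = q) :
    D.stp (D.prin h Λ) q G i x = D.avgOp (q+i) G x := by
  cases i with
  | zero => rfl
  | succ i =>
    simp only [stp]
    rw [if_pos (D.prin_back h Λ (Nat.le_add_right q i) hx)]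
    rfl

lemma stp_orth (q : ℕ) (G) (hG : Measurable G) (i : ℕ) (φ : (Fin d → ℝ) → ℝ≥0∞)
    (hφ : D.Lev (q+i) φ) :
    ∫⁻ x, φ x * D.stp (D.prin h Λ) q G (i+1) x = ∫⁻ x, φ x * D.stp (D.prin h Λ) q G i x := by
  classical
  set π := D.prin h Λ with hπ
  let P : (Fin d → ℝ) → ℝ≥0∞ := fun x => if π (q+i) x = q then φ x else 0
  let R : (Fin d → ℝ) → ℝ≥0∞ := fun x => if π (q+i) x = q then 0 else φ x
  have hP : D.Lev (q+i) P := by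
    intro x y hxy; have h1 := D.prin_lev h Λ (q+i) x y hxy; rw [← hπ] at h1; simp only [P]; rw [h1, hφ x y hxy]
  have hR : D.Lev (q+i) R := by
    intro x y hxy; have h1 := D.prin_lev h Λ (q+i) x y hxy; rw [← hπ] at h1; simp only [R]; rw [h1, hφ x y hxy]
  have e1 : ∀ x, φ x * D.stp π q G (i+1) x = P x * D.avgOp (q+i+1) G x + R x * D.stp π q G i x := by
    intro x
    simp only [stp, P, R]
    split_ifs <;> simp
  have e2 : ∀ x, φ x * D.stp π q G i x = P x * D.avgOp (q+i) G x + R x * D.stp π q G i x := by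
    intro x
    simp only [P, R]
    split_ifs with hx
    · simp [D.stp_of_prin h Λ q G i x hx, hπ]
    · simp
  simp only [e1, e2]
  have hPm : ∀ k, Measurable fun x => P x * D.avgOp k G x := fun k =>
    hP.measurable.mul (D.lev_avgOp k G).measurable
  rw [lintegral_add_left (hPm _), lintegral_add_left (hPm _),
    D.lintegral_lev_mul_avgOp _ hP hG, D.lintegral_lev_mul_avgOp _ (hP.mono (Nat.le_succ _)) hG]

lemma avgOp_succ_le (k : ℕ) (G) (x) : D.avgOp (k+1) G x ≤ 2 ^ d * D.avgOp k G x := by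
  simp only [avgOp, mean]
  have hv : (D.cell k (D.idx k x)).vol = 2 ^ d * (D.cell (k+1) (D.idx (k+1) x)).vol := by
    rw [Cube.vol_eq, Cube.vol_eq, ← mul_pow]
    congr 1
    simp only [cell]
    rw [← ENNReal.ofReal_ofNat 2, ← ENNReal.ofReal_mul (by norm_num)]
    congr 1
    rw [pow_succ]; field_simp
  have hv0 := (D.cell (k+1) (D.idx (k+1) x)).vol_ne_zero
  have hvt := (D.cell (k+1) (D.idx (k+1) x)).vol_ne_top
  rw [hv, ← mul_div_assoc, ENNReal.mul_div_mul_left _ _ (by simp) (by simp)]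
  gcongr
  exact D.cell_subset (Nat.le_succ k) x

lemma stp_bound_scalar (hΛ : 1 ≤ Λ) (j : ι) (q : ℕ) (x) (i : ℕ)
    (hx : D.prin h Λ (q+i) x = q) :
    D.avgOp (q+i+1) (h j) x ≤ 2 ^ d * Λ * D.avgOp q (h j) x := by
  refine (D.avgOp_succ_le _ _ _).trans ?_
  rw [mul_assoc]
  gcongr
  exact D.avgOp_le_of_prin h Λ hΛ hx j

lemma one_le_two_pow_mul (hΛ : 1 ≤ Λ) : 1 ≤ 2 ^ d * Λ := by
  have : (1:ℝ≥0∞) ≤ 2 ^ d := one_le_pow_of_one_le' (by norm_num) d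
  calc (1:ℝ≥0∞) = 1 * 1 := by simp
    _ ≤ _ := by gcongr

lemma mink_avg (μ : Measure Ω) [SigmaFinite μ] {p : ℝ} (hp : 1 < p)
    (G : (Fin d → ℝ) → Ω → ℝ≥0∞) (hG : Measurable (Function.uncurry G))
    (g : (Fin d → ℝ) → ℝ≥0∞) (hg : ∀ y, ∫⁻ ω, G y ω ^ p ∂μ ≤ g y ^ p) (k : ℕ) (x) :
    ∫⁻ ω, D.avgOp k (fun y => G y ω) x ^ p ∂μ ≤ D.avgOp k g x ^ p := by
  simp only [avgOp, mean]
  have hp0 : 0 ≤ p := by linarith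
  set Q := D.cell k (D.idx k x)
  have hv0 := Q.vol_ne_zero
  have hvt := Q.vol_ne_top
  simp only [ENNReal.div_rpow_of_nonneg _ _ hp0]
  simp only [div_eq_mul_inv]
  rw [lintegral_mul_const']
  · gcongr
    exact minkowski (volume.restrict Q.set) μ hp G hG g hg
  · rw [ENNReal.inv_ne_top]
    intro h0
    rw [ENNReal.rpow_eq_zero_iff] at h0
    rcases h0 with h0 | h0
    · exact hv0 h0.1
    · exact hvt h0.1

lemma stp_norm_bound (hΛ : 1 ≤ Λ) (j : ι) (q : ℕ) (x)
    (μ : Measure Ω) [SigmaFinite μ] {p : ℝ} (hp : 1 < p)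
    (G : (Fin d → ℝ) → Ω → ℝ≥0∞) (hG : Measurable (Function.uncurry G))
    (hg : ∀ y, ∫⁻ ω, G y ω ^ p ∂μ ≤ h j y ^ p) (i : ℕ) :
    ∫⁻ ω, D.stp (D.prin h Λ) q (fun y => G y ω) i x ^ p ∂μ ≤
      (2 ^ d * Λ * D.avgOp q (h j) x) ^ p := by
  have hp0 : 0 ≤ p := by linarith
  induction i with
  | zero =>
    refine (D.mink_avg μ hp G hG (h j) hg q x).trans ?_
    exact ENNReal.rpow_le_rpow (le_mul_of_one_le_left' (one_le_two_pow_mul Λ hΛ)) hp0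
  | succ i ih =>
    simp only [stp]
    by_cases hx : D.prin h Λ (q+i) x = q
    · simp only [hx, if_true]
      refine (D.mink_avg μ hp G hG (h j) hg _ x).trans ?_
      exact ENNReal.rpow_le_rpow (D.stp_bound_scalar h Λ hΛ j q x i hx) hp0
    · simp only [hx, if_false]
      exact ih

lemma stp_sup_bound (hΛ : 1 ≤ Λ) (j : ι) (q : ℕ) (x)
    (G : (Fin d → ℝ) → ℝ≥0∞) (hg : ∀ᵐ y, G y ≤ h j y) (i : ℕ) :
    D.stp (D.prin h Λ) q G i x ≤ 2 ^ d * Λ * D.avgOp q (h j) x := by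
  have hle : ∀ k, D.avgOp k G x ≤ D.avgOp k (h j) x := by
    intro k
    simp only [avgOp, mean]
    gcongr ?_ / _
    exact lintegral_mono_ae (ae_restrict_of_ae hg)
  induction i with
  | zero => exact (hle q).trans (le_mul_of_one_le_left' (one_le_two_pow_mul Λ hΛ))
  | succ i ih =>
    simp only [stp]
    by_cases hx : D.prin h Λ (q+i) x = q
    · simp only [hx, if_true]
      exact (hle _).trans (D.stp_bound_scalar h Λ hΛ j q x i hx)
    · simp only [hx, if_false]
      exact ih

lemma lev_runMax {f : ℕ → (Fin d → ℝ) × Ω → ℝ≥0∞} (q : ℕ) (ω : Ω)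
    (hf : ∀ i, D.Lev (q+i) (fun x => f i (x, ω))) (i : ℕ) :
    D.Lev (q+i) (fun x => runMax f i (x, ω)) := by
  induction i with
  | zero => exact hf 0
  | succ i ih => exact (ih.mono (Nat.le_succ _)).comp₂ (hf (i+1)) max

/-- the strong-type bound for the stopped maximal function on one cell -/
lemma stp_doob (hΛ : 1 ≤ Λ) (j : ι) (q : ℕ) (n : Fin d → ℤ)
    (μ : Measure Ω) [SigmaFinite μ] {p : ℝ} (hp : 1 < p)
    (G : (Fin d → ℝ) → Ω → ℝ≥0∞) (hG : Measurable (Function.uncurry G))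
    (hg : ∀ y, ∫⁻ ω, G y ω ^ p ∂μ ≤ h j y ^ p) :
    ∫⁻ z, (⨆ i, D.stp (D.prin h Λ) q (fun y => G y z.2) i z.1) ^ p
      ∂((volume.restrict (D.cell q n).set).prod μ) ≤
    ENNReal.ofReal (p/(p-1)) ^ p * ((2 ^ d * Λ * mean (h j) (D.cell q n)) ^ p * (D.cell q n).vol) := by
  let f : ℕ → (Fin d → ℝ) × Ω → ℝ≥0∞ := fun i z => D.stp (D.prin h Λ) q (fun y => G y z.2) i z.1
  have hf : ∀ i, Measurable (f i) := D.measurable_stp (D.prin_lev h Λ) q G hG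
  refine doob _ hp f hf _ ?_ ?_
  · intro i
    rw [lintegral_prod _ ((hf i).pow_const p).aemeasurable]
    calc ∫⁻ x in (D.cell q n).set, ∫⁻ ω, f i (x, ω) ^ p ∂μ
        ≤ ∫⁻ x in (D.cell q n).set, (2 ^ d * Λ * mean (h j) (D.cell q n)) ^ p := by
          refine setLIntegral_mono measurable_const fun x hx => ?_
          rw [mem_cell] at hx
          have := D.stp_norm_bound h Λ hΛ j q x μ hp G hG hg i
          rwa [avgOp, hx] at this
      _ = _ := by rw [setLIntegral_const]; rfl
  · intro i
    have hm : ∀ l, Measurable fun z => runMax f i z ^ (p-1) * f l z := fun l =>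
      ((measurable_runMax hf i).pow_const _).mul (hf l)
    rw [lintegral_prod_symm _ (hm _).aemeasurable, lintegral_prod_symm _ (hm _).aemeasurable]
    refine lintegral_congr fun ω => ?_
    rw [← lintegral_indicator (D.cell q n).meas, ← lintegral_indicator (D.cell q n).meas]
    let φ : (Fin d → ℝ) → ℝ≥0∞ :=
      (D.cell q n).set.indicator (fun x => runMax f i (x, ω) ^ (p-1))
    have hφ : D.Lev (q+i) φ := by
      intro x y hxy
      have h1 : x ∈ (D.cell q n).set ↔ y ∈ (D.cell q n).set := by
        rw [mem_cell, mem_cell, D.idx_eq_of_le (Nat.le_add_right q i) hxy]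
      have h2 : runMax f i (x, ω) = runMax f i (y, ω) :=
        D.lev_runMax q ω (fun l => D.stp_lev (D.prin_lev h Λ) q (fun y => G y ω) l) i x y hxy
      by_cases hx : x ∈ (D.cell q n).set
      · simp only [φ]
        rw [Set.indicator_of_mem hx, Set.indicator_of_mem (h1.1 hx), h2]
      · simp only [φ]
        rw [Set.indicator_of_notMem hx, Set.indicator_of_notMem (fun hy => hx (h1.2 hy))]
    have key := D.stp_orth h Λ q (fun y => G y ω) (hG.comp measurable_prodMk_right) i φ hφ
    have conv : ∀ l, ∀ x, (D.cell q n).set.indicator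
        (fun x => runMax f i (x, ω) ^ (p-1) * f l (x, ω)) x
        = φ x * D.stp (D.prin h Λ) q (fun y => G y ω) l x := by
      intro l x
      by_cases hx : x ∈ (D.cell q n).set <;> simp [φ, f, hx]
    simp only [conv]
    exact key

end DGrid

namespace DGrid
variable {d : ℕ} {ι Ω : Type*} [MeasurableSpace Ω]
variable (D : DGrid d) (h : ι → (Fin d → ℝ) → ℝ≥0∞) (Λ : ℝ≥0∞)

/-- the vector-valued domination hypothesis with exponent parameter `u` (`u = 0` is the sup case) -/
def VDom (μ : Measure Ω) (u : ℝ) (G : (Fin d → ℝ) → Ω → ℝ≥0∞) (g : (Fin d → ℝ) → ℝ≥0∞) : Prop :=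
  if u = 0 then ∀ y, ∀ᵐ ω ∂μ, G y ω ≤ g y else ∀ y, ∫⁻ ω, G y ω ^ (1/u) ∂μ ≤ g y ^ (1/u)

lemma local_one (hΛ : 1 ≤ Λ) (j : ι) (hhm : Measurable (h j)) (q : ℕ) (n : Fin d → ℤ)
    (μ : Measure Ω) [SigmaFinite μ] {u e : ℝ} (hu0 : 0 ≤ u) (hu1 : u < 1) (he : 0 < e)
    (G : (Fin d → ℝ) → Ω → ℝ≥0∞) (hG : Measurable (Function.uncurry G))
    (hg : VDom μ u G (h j)) :
    ∃ (φ : (Fin d → ℝ) × Ω → ℝ≥0∞) (κ : ℝ≥0∞), Measurable φ ∧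
      (∀ᵐ z ∂((volume.restrict (D.cell q n).set).prod μ),
        (⨆ i, D.stp (D.prin h Λ) q (fun y => G y z.2) i z.1) ^ e ≤ κ * φ z ^ (u * e)) ∧
      κ * (∫⁻ z, φ z ∂((volume.restrict (D.cell q n).set).prod μ)) ^ (u * e) ≤
        (ENNReal.ofReal (1/(1-u)) * (2 ^ d * Λ * mean (h j) (D.cell q n))) ^ e *
          (D.cell q n).vol ^ (u * e) := by
  have hMm : Measurable fun z : (Fin d → ℝ) × Ω =>
      (⨆ i, D.stp (D.prin h Λ) q (fun y => G y z.2) i z.1) :=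
    Measurable.iSup (D.measurable_stp (D.prin_lev h Λ) q G hG)
  rcases eq_or_lt_of_le hu0 with h0 | h0
  · subst h0
    refine ⟨fun _ => 1, (2 ^ d * Λ * mean (h j) (D.cell q n)) ^ e, measurable_const, ?_, ?_⟩
    · simp only [VDom, if_true] at hg
      have hset : MeasurableSet {z : (Fin d → ℝ) × Ω | G z.1 z.2 ≤ h j z.1} :=
        measurableSet_le hG (hhm.comp measurable_fst)
      have h1 : ∀ᵐ ω ∂μ, ∀ᵐ y, G y ω ≤ h j y :=
        (Measure.ae_ae_comm hset).1 (Filter.Eventually.of_forall hg)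
      have h2 : ∀ᵐ z ∂((volume.restrict (D.cell q n).set).prod μ), ∀ᵐ y, G y z.2 ≤ h j y :=
        (Measure.quasiMeasurePreserving_snd).ae h1
      have h3 : ∀ᵐ z ∂((volume.restrict (D.cell q n).set).prod μ), z.1 ∈ (D.cell q n).set :=
        (Measure.quasiMeasurePreserving_fst).ae (ae_restrict_mem (D.cell q n).meas)
      filter_upwards [h2, h3] with z hz hz3
      rw [mem_cell] at hz3
      simp only [ENNReal.one_rpow, mul_one]
      refine ENNReal.rpow_le_rpow (iSup_le fun i => ?_) he.le
      have := D.stp_sup_bound h Λ hΛ j q z.1 (fun y => G y z.2) hz i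
      rwa [avgOp, hz3] at this
    · simp
  · have hp : 1 < 1/u := by rw [lt_div_iff₀ h0]; linarith
    refine ⟨fun z => (⨆ i, D.stp (D.prin h Λ) q (fun y => G y z.2) i z.1) ^ (1/u), 1,
      hMm.pow_const _, ?_, ?_⟩
    · refine Filter.Eventually.of_forall fun z => ?_
      rw [← ENNReal.rpow_mul, one_mul]
      apply le_of_eq
      congr 1
      field_simp
    · simp only [VDom, h0.ne', if_false] at hg
      have := D.stp_doob h Λ hΛ j q n μ hp G hG hg
      have hc : 1/u/(1/u-1) = 1/(1-u) := by
        have : 1 - u ≠ 0 := by linarith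
        field_simp
      rw [hc] at this
      rw [one_mul]
      refine (ENNReal.rpow_le_rpow this (by positivity)).trans ?_
      have hue : 0 ≤ u * e := by positivity
      rw [← mul_assoc, ENNReal.mul_rpow_of_nonneg _ _ hue, ← ENNReal.mul_rpow_of_nonneg _ _ (by positivity : 0 ≤ 1/u), ← ENNReal.rpow_mul]
      apply le_of_eq
      congr 2
      field_simp

lemma local_bound [Fintype ι] (hΛ : 1 ≤ Λ) (hhm : ∀ j, Measurable (h j)) (q : ℕ) (n : Fin d → ℤ)
    (μ : Measure Ω) [SigmaFinite μ] {u e : ι → ℝ} (hu0 : ∀ j, 0 ≤ u j) (hu1 : ∀ j, u j < 1)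
    (he : ∀ j, 0 < e j) (hue : ∑ j, u j * e j = 1)
    (G : ι → (Fin d → ℝ) → Ω → ℝ≥0∞) (hG : ∀ j, Measurable (Function.uncurry (G j)))
    (hg : ∀ j, VDom μ (u j) (G j) (h j)) :
    ∫⁻ z, ∏ j, (⨆ i, D.stp (D.prin h Λ) q (fun y => G j y z.2) i z.1) ^ e j
      ∂((volume.restrict (D.cell q n).set).prod μ) ≤
    (∏ j, (ENNReal.ofReal (1/(1-u j)) * (2 ^ d * Λ)) ^ e j) *
      ((∏ j, mean (h j) (D.cell q n) ^ e j) * (D.cell q n).vol) := by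
  choose φ κ hφ hae hb using fun j =>
    D.local_one h Λ hΛ j (hhm j) q n μ (hu0 j) (hu1 j) (he j) (G j) (hG j) (hg j)
  have hue0 : ∀ j, 0 ≤ u j * e j := fun j => mul_nonneg (hu0 j) (he j).le
  calc _ ≤ ∫⁻ z, ∏ j, (κ j * φ j z ^ (u j * e j)) ∂((volume.restrict (D.cell q n).set).prod μ) := by
        refine lintegral_mono_ae ?_
        filter_upwards [ae_all_iff.2 hae] with z hz
        exact Finset.prod_le_prod' fun j _ => hz j
    _ = (∏ j, κ j) * ∫⁻ z, ∏ j, φ j z ^ (u j * e j) ∂((volume.restrict (D.cell q n).set).prod μ) := by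
        simp only [Finset.prod_mul_distrib]
        rw [lintegral_const_mul]
        exact Finset.measurable_fun_prod _ fun j _ => (hφ j).pow_const _
    _ ≤ (∏ j, κ j) * ∏ j, (∫⁻ z, φ j z ∂((volume.restrict (D.cell q n).set).prod μ)) ^ (u j * e j) := by
        gcongr
        exact ENNReal.lintegral_prod_norm_pow_le _ (fun j _ => (hφ j).aemeasurable) hue (fun j _ => hue0 j)
    _ = ∏ j, (κ j * (∫⁻ z, φ j z ∂((volume.restrict (D.cell q n).set).prod μ)) ^ (u j * e j)) := by
        rw [Finset.prod_mul_distrib]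
    _ ≤ ∏ j, ((ENNReal.ofReal (1/(1-u j)) * (2 ^ d * Λ * mean (h j) (D.cell q n))) ^ e j *
          (D.cell q n).vol ^ (u j * e j)) := Finset.prod_le_prod' fun j _ => hb j
    _ = _ := by
        rw [← mul_assoc, ← Finset.prod_mul_distrib, Finset.prod_mul_distrib]
        congr 1
        · refine Finset.prod_congr rfl fun j _ => ?_
          rw [← ENNReal.mul_rpow_of_nonneg _ _ (he j).le]
          congr 1
          ring
        · have : ∀ s : Finset ι, ∏ j ∈ s, (D.cell q n).vol ^ (u j * e j) = (D.cell q n).vol ^ (∑ j ∈ s, u j * e j) := by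
            intro s
            induction s using Finset.cons_induction with
            | empty => simp
            | cons a s ha ih =>
              rw [Finset.prod_cons, Finset.sum_cons, ih,
                ENNReal.rpow_add _ _ (D.cell q n).vol_ne_zero (D.cell q n).vol_ne_top]
          rw [this, hue, ENNReal.rpow_one]

lemma core [Fintype ι] (hΛ : 1 ≤ Λ) (hhm : ∀ j, Measurable (h j))
    (μ : Measure Ω) [SigmaFinite μ] {u e : ι → ℝ} (hu0 : ∀ j, 0 ≤ u j) (hu1 : ∀ j, u j < 1)
    (he : ∀ j, 0 < e j) (hue : ∑ j, u j * e j = 1)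
    (G : ι → (Fin d → ℝ) → Ω → ℝ≥0∞) (hG : ∀ j, Measurable (Function.uncurry (G j)))
    (hg : ∀ j, VDom μ (u j) (G j) (h j)) :
    ∫⁻ z : (Fin d → ℝ) × Ω, ⨆ k, ∏ j, D.avgOp k (fun y => G j y z.2) z.1 ^ e j ∂(volume.prod μ) ≤
    (∏ j, (ENNReal.ofReal (1/(1-u j)) * (2 ^ d * Λ)) ^ e j) *
      ∑' Q : D.prinSet h Λ, (∏ j, mean (h j) Q ^ e j) * (Q : Cube d).vol := by
  classical
  let I := {qn : ℕ × (Fin d → ℤ) // ∀ x, D.idx qn.1 x = qn.2 → D.prin h Λ qn.1 x = qn.1}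
  let M : ℕ → (Fin d → ℝ) × Ω → ℝ≥0∞ := fun q z =>
    ∏ j, (⨆ i, D.stp (D.prin h Λ) q (fun y => G j y z.2) i z.1) ^ e j
  have hM : ∀ q, Measurable (M q) := fun q => Finset.measurable_fun_prod _ fun j _ =>
    (Measurable.iSup (D.measurable_stp (D.prin_lev h Λ) q (G j) (hG j))).pow_const _
  have hcs : ∀ a : I, MeasurableSet ((D.cell a.1.1 a.1.2).set ×ˢ (Set.univ : Set Ω)) := fun a =>
    (D.cell _ _).meas.prod MeasurableSet.univ
  calc _ ≤ ∫⁻ z : (Fin d → ℝ) × Ω, ∑' a : I,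
        ((D.cell a.1.1 a.1.2).set ×ˢ (Set.univ : Set Ω)).indicator (M a.1.1) z ∂(volume.prod μ) := by
        refine lintegral_mono fun z => iSup_le fun k => ?_
        set q := D.prin h Λ k z.1 with hq
        have hqk : q ≤ k := D.prin_le h Λ k z.1
        have hqq : D.prin h Λ q z.1 = q := D.prin_prin h Λ k z.1
        let a : I := ⟨(q, D.idx q z.1), fun x hx =>
          (D.prin_lev h Λ q x z.1 hx).trans hqq⟩
        refine le_trans ?_ (ENNReal.le_tsum a)
        rw [Set.indicator_of_mem]
        · refine Finset.prod_le_prod' fun j _ => ENNReal.rpow_le_rpow ?_ (he j).le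
          obtain ⟨i, hi⟩ := Nat.exists_eq_add_of_le hqk
          refine le_trans (le_of_eq ?_) (le_iSup _ i)
          show _ = D.stp (D.prin h Λ) q (fun y => G j y z.2) i z.1
          rw [D.stp_of_prin h Λ q _ i z.1 (by rw [← hi]), ← hi]
        · exact ⟨D.mem_cell_self q z.1, trivial⟩
    _ = ∑' a : I, ∫⁻ z, M a.1.1 z ∂((volume.restrict (D.cell a.1.1 a.1.2).set).prod μ) := by
        rw [lintegral_tsum fun a => ((hM _).indicator (hcs a)).aemeasurable]
        refine tsum_congr fun a => ?_
        rw [lintegral_indicator (hcs a), ← Measure.prod_restrict, Measure.restrict_univ]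
    _ ≤ ∑' a : I, (∏ j, (ENNReal.ofReal (1/(1-u j)) * (2 ^ d * Λ)) ^ e j) *
      ((∏ j, mean (h j) (D.cell a.1.1 a.1.2) ^ e j) * (D.cell a.1.1 a.1.2).vol) :=
        ENNReal.tsum_le_tsum fun a => D.local_bound h Λ hΛ hhm _ _ μ hu0 hu1 he hue G hG hg
    _ = (∏ j, (ENNReal.ofReal (1/(1-u j)) * (2 ^ d * Λ)) ^ e j) * ∑' a : I,
      ((∏ j, mean (h j) (D.cell a.1.1 a.1.2) ^ e j) * (D.cell a.1.1 a.1.2).vol) := ENNReal.tsum_mul_left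
    _ ≤ _ := by
        gcongr
        let F : I → D.prinSet h Λ := fun a => ⟨D.cell a.1.1 a.1.2, a.1.1, a.1.2, a.2, rfl⟩
        have hF : Function.Injective F := by
          intro a b hab
          have := D.cell_inj (congrArg Subtype.val hab)
          exact Subtype.ext (Prod.ext this.1 this.2)
        exact ENNReal.tsum_comp_le_tsum_of_injective hF
          (fun Q : D.prinSet h Λ => (∏ j, mean (h j) Q ^ e j) * (Q : Cube d).vol)

end DGrid

lemma sparse_sum_le {d : ℕ} {S : Set (Cube d)} (hS : IsSparse S) (a : Cube d → ℝ≥0∞)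
    (Φ : (Fin d → ℝ) → ℝ≥0∞) (h : ∀ Q ∈ S, ∀ x ∈ Q.set, a Q ≤ Φ x) :
    ∑' Q : S, a Q * (Q : Cube d).vol ≤ 2 * ∫⁻ x, Φ x := by
  classical
  obtain ⟨E, hE, hdis⟩ := hS
  rw [ENNReal.tsum_eq_iSup_sum]
  refine iSup_le fun F => ?_
  calc ∑ Q ∈ F, a Q * (Q : Cube d).vol
      ≤ ∑ Q ∈ F, 2 * ∫⁻ x in E Q, Φ x := by
        refine Finset.sum_le_sum fun Q _ => ?_
        obtain ⟨h1, h2, h3⟩ := hE Q Q.2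
        calc a Q * (Q : Cube d).vol ≤ a Q * (2 * volume (E Q)) := by gcongr
          _ = 2 * ∫⁻ x in E Q, a Q := by rw [setLIntegral_const]; ring
          _ ≤ 2 * ∫⁻ x in E Q, Φ x := by
            gcongr 2 * ?_
            exact setLIntegral_mono' h1 fun x hx => h Q Q.2 x (h2 hx)
    _ = 2 * ∫⁻ x in ⋃ Q ∈ F, E Q, Φ x := by
        rw [← Finset.mul_sum, lintegral_biUnion_finset]
        · intro Q _ Q' _ hne
          exact hdis Q.2 Q'.2 (fun h => hne (Subtype.ext h))
        · exact fun Q _ => (hE Q Q.2).1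
    _ ≤ 2 * ∫⁻ x, Φ x := by
        gcongr 2 * ?_
        exact setLIntegral_le_lintegral _ _

lemma mean_le_of_subset {d : ℕ} (G : (Fin d → ℝ) → ℝ≥0∞) (Q R : Cube d) (K : ℝ≥0∞)
    (hsub : ∫⁻ y in Q.set, G y ≤ ∫⁻ y in R.set, G y) (hv : R.vol ≤ K * Q.vol) :
    mean G Q ≤ K * mean G R := by
  simp only [mean]
  have hR0 := R.vol_ne_zero
  have hRt := R.vol_ne_top
  refine ENNReal.div_le_of_le_mul ?_
  calc ∫⁻ y in Q.set, G y ≤ ∫⁻ y in R.set, G y := hsub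
    _ = (∫⁻ y in R.set, G y) / R.vol * R.vol := (ENNReal.div_mul_cancel hR0 hRt).symm
    _ ≤ (∫⁻ y in R.set, G y) / R.vol * (K * Q.vol) := by gcongr
    _ = _ := by ring

lemma floor_shift (c ℓ δ a s : ℝ) (k : ℕ) (hδ : 0 < δ) (hℓ : ℓ = 2 ^ k * δ) (hs : s ≤ δ / 3) :
    ∃ b : Bool, ∀ y, a ≤ y → y < a + s →
      ⌊(y - (if b then c + ℓ/3 else c)) / δ⌋ = ⌊(a - (if b then c + ℓ/3 else c)) / δ⌋ := by
  have aux : ∀ c' : ℝ, (¬ ∀ y, a ≤ y → y < a + s → ⌊(y - c') / δ⌋ = ⌊(a - c') / δ⌋) →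
      ∃ n : ℤ, a < c' + δ * n ∧ c' + δ * n < a + s := by
    intro c' hc
    push Not at hc
    obtain ⟨y, h1, h2, h3⟩ := hc
    have hle : ⌊(a - c') / δ⌋ ≤ ⌊(y - c') / δ⌋ := by gcongr
    have hlt : ⌊(a - c') / δ⌋ < ⌊(y - c') / δ⌋ := lt_of_le_of_ne hle (Ne.symm h3)
    refine ⟨⌊(y - c') / δ⌋, ?_, ?_⟩
    · have := Int.floor_lt.1 hlt
      rw [div_lt_iff₀ hδ] at this
      linarith
    · have := Int.floor_le ((y - c') / δ)
      rw [le_div_iff₀ hδ] at this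
      linarith
  by_contra hcon
  push Not at hcon
  obtain ⟨n, hn1, hn2⟩ := aux c (by have := hcon false; push Not; simpa using this)
  obtain ⟨n', hn1', hn2'⟩ := aux (c + ℓ/3) (by have := hcon true; push Not; simpa using this)
  have hne : 3 * (n' - n) + (2:ℤ) ^ k ≠ 0 := by
    intro h0
    have h3 : (3:ℤ) ∣ 2 ^ k := ⟨n - n', by linarith⟩
    have := Int.Prime.dvd_pow' Nat.prime_three h3
    revert this; decide
  have hcast : δ * (3 * (n' - n) + (2:ℝ) ^ k) = 3 * ((c + ℓ/3 + δ * n') - (c + δ * n)) := by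
    rw [hℓ]; ring
  rcases lt_or_gt_of_ne hne with hlt | hgt
  · have h1 : 3 * (n' - n) + (2:ℤ) ^ k ≤ -1 := by omega
    have h2 : (3 * (n' - n) + (2:ℝ) ^ k) ≤ -1 := by exact_mod_cast h1
    nlinarith
  · have h1 : 1 ≤ 3 * (n' - n) + (2:ℤ) ^ k := by omega
    have h2 : (1:ℝ) ≤ (3 * (n' - n) + (2:ℝ) ^ k) := by exact_mod_cast h1
    nlinarith

namespace DGrid
variable {d : ℕ} {ι : Type*}

def shift (D : DGrid d) (α : Fin d → Bool) : DGrid d :=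
  ⟨fun i => if α i then D.base i + D.len / 3 else D.base i, D.len, D.pos⟩

lemma shift_false (D : DGrid d) : D.shift (fun _ => false) = D := by
  simp [shift]

/-- dyadic maximal product -/
def mx [Fintype ι] (D : DGrid d) (e : ι → ℝ) (G : ι → (Fin d → ℝ) → ℝ≥0∞) (x : Fin d → ℝ) : ℝ≥0∞ :=
  ⨆ k, ∏ j, D.avgOp k (G j) x ^ e j

lemma measurable_mx [Fintype ι] (D : DGrid d) (e : ι → ℝ) (G : ι → (Fin d → ℝ) → ℝ≥0∞) :
    Measurable (D.mx e G) :=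
  Measurable.iSup fun k => Finset.measurable_fun_prod _ fun j _ =>
    (D.lev_avgOp k (G j)).measurable.pow_const _

lemma small_cube [Fintype ι] (D : DGrid d) {e : ι → ℝ} (he : ∀ j, 0 < e j)
    (G : ι → (Fin d → ℝ) → ℝ≥0∞) (Q : Cube d) (hQ : Q.side < D.len / 3) (x) (hx : x ∈ Q.set) :
    ∃ α, ∏ j, mean (G j) Q ^ e j ≤ (∏ j, ((6:ℝ≥0∞) ^ d) ^ e j) * (D.shift α).mx e G x := by
  have hl := D.pos
  have hs := Q.side_pos
  obtain ⟨k, hk1, hk2⟩ := exists_nat_pow_near (x := D.len / (3 * Q.side)) (y := 2)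
    (by rw [le_div_iff₀ (by positivity)]; linarith) (by norm_num)
  have hδ : 0 < D.len / 2 ^ k := by positivity
  have hs1 : Q.side ≤ D.len / 2 ^ k / 3 := by
    rw [le_div_iff₀ (by positivity)] at hk1
    rw [le_div_iff₀ (by positivity), le_div_iff₀ (by positivity)]
    linarith
  have hs2 : D.len / 2 ^ k ≤ 6 * Q.side := by
    rw [div_lt_iff₀ (by positivity), pow_succ] at hk2
    rw [div_le_iff₀ (by positivity)]
    linarith
  choose α hα using fun i => floor_shift (D.base i) D.len (D.len / 2 ^ k) (Q.corner i) Q.side k hδ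
    (by field_simp) hs1
  have hidx : ∀ y ∈ Q.set, (D.shift α).idx k y = (D.shift α).idx k Q.corner := fun y hy =>
    funext fun i => hα i (y i) (hy i).1 (hy i).2
  refine ⟨α, ?_⟩
  refine le_trans ?_ (mul_le_mul_right (le_iSup _ k) _)
  rw [← Finset.prod_mul_distrib]
  refine Finset.prod_le_prod' fun j _ => ?_
  rw [← ENNReal.mul_rpow_of_nonneg _ _ (he j).le]
  refine ENNReal.rpow_le_rpow ?_ (he j).le
  refine mean_le_of_subset _ _ _ _ ?_ ?_
  · refine lintegral_mono_set fun y hy => ?_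
    rw [mem_cell, hidx y hy, hidx x hx]
  · rw [Cube.vol_eq, Cube.vol_eq, ← mul_pow]
    gcongr
    rw [← ENNReal.ofReal_ofNat 6, ← ENNReal.ofReal_mul (by norm_num)]
    exact ENNReal.ofReal_le_ofReal hs2

/-- enlarged box -/
def box (D : DGrid d) (k : ℕ) : Cube d :=
  ⟨fun i => D.base i - 2 ^ k * D.len, 3 * 2 ^ k * D.len, by have := D.pos; positivity⟩

lemma big_cube [Fintype ι] [Nonempty ι] (D : DGrid d) {e : ι → ℝ} (he : ∀ j, 0 < e j)
    (G : ι → (Fin d → ℝ) → ℝ≥0∞) (hG : ∀ j, ∀ x ∉ (D.cell 0 0).set, G j x = 0)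
    (Q : Cube d) (hQ : D.len / 3 ≤ Q.side) (x) (hx : x ∈ Q.set) :
    ∃ k, ∏ j, mean (G j) Q ^ e j ≤ (D.box k).set.indicator (fun _ =>
      (∏ j, ((3 * 2⁻¹ ^ k : ℝ≥0∞) ^ d) ^ e j) * ∏ j, mean (G j) (D.cell 0 0) ^ e j) x := by
  have hl := D.pos
  have hs := Q.side_pos
  obtain ⟨k, hk1, hk2⟩ := exists_nat_pow_near (x := 3 * Q.side / D.len) (y := 2)
    (by rw [le_div_iff₀ (by positivity)]; linarith) (by norm_num)
  refine ⟨k, ?_⟩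
  by_cases hne : (Q.set ∩ (D.cell 0 0).set).Nonempty
  · obtain ⟨y, hy1, hy2⟩ := hne
    have hbox : x ∈ (D.box k).set := by
      intro i
      have h1 := hx i
      have h2 := hy1 i
      have h3 := hy2 i
      simp only [cell, box] at h3 ⊢
      simp at h3
      rw [div_lt_iff₀ hl, pow_succ] at hk2
      have h2k : (1:ℝ) ≤ 2 ^ k := one_le_pow₀ (by norm_num)
      constructor <;> nlinarith
    rw [Set.indicator_of_mem hbox, ← Finset.prod_mul_distrib]
    refine Finset.prod_le_prod' fun j _ => ?_
    rw [← ENNReal.mul_rpow_of_nonneg _ _ (he j).le]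
    refine ENNReal.rpow_le_rpow ?_ (he j).le
    refine mean_le_of_subset _ _ _ _ ?_ ?_
    · calc ∫⁻ y in Q.set, G j y ≤ ∫⁻ y, G j y := setLIntegral_le_lintegral _ _
        _ = ∫⁻ y in (D.cell 0 0).set, G j y := by
          rw [← lintegral_indicator (D.cell 0 0).meas]
          refine lintegral_congr fun y => ?_
          by_cases hy : y ∈ (D.cell 0 0).set
          · rw [Set.indicator_of_mem hy]
          · rw [Set.indicator_of_notMem hy, hG j y hy]
    · rw [Cube.vol_eq, Cube.vol_eq, ← mul_pow]
      gcongr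
      have : (3 * 2⁻¹ ^ k : ℝ≥0∞) = ENNReal.ofReal (3 * (2⁻¹) ^ k) := by
        rw [ENNReal.ofReal_mul (by norm_num), ENNReal.ofReal_pow (by norm_num),
          ENNReal.ofReal_inv_of_pos (by norm_num)]
        simp
      rw [this, ← ENNReal.ofReal_mul (by positivity)]
      refine ENNReal.ofReal_le_ofReal ?_
      rw [le_div_iff₀ hl] at hk1
      simp only [cell]
      rw [inv_pow, mul_right_comm, ← div_eq_mul_inv, le_div_iff₀ (by positivity)]
      simp only [pow_zero, div_one]
      linarith
  · have hz : ∀ j, mean (G j) Q = 0 := by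
      intro j
      have : ∫⁻ y in Q.set, G j y = 0 := by
        rw [setLIntegral_congr_fun (g := fun _ => 0) Q.meas]
        · simp
        · intro y hy
          exact hG j y fun hy' => hne ⟨y, hy, hy'⟩
      simp [mean, this]
    obtain ⟨j⟩ := ‹Nonempty ι›
    rw [Finset.prod_eq_zero (Finset.mem_univ j)]
    · exact zero_le
    · rw [hz j, ENNReal.zero_rpow_of_pos (he j)]

/-- constant in the geometric lemma -/
def geoC (d : ℕ) {ι : Type*} [Fintype ι] (e : ι → ℝ) : ℝ≥0∞ :=
  ∑' k : ℕ, (∏ j, ((3 * 2⁻¹ ^ k : ℝ≥0∞) ^ d) ^ e j) * (3 * 2 ^ k) ^ d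

lemma prod_rpow_eq (a : ℝ≥0∞) (ha : a ≠ 0) (ha' : a ≠ ∞) [Fintype ι] (e : ι → ℝ) :
    ∏ j, a ^ e j = a ^ (∑ j, e j) := by
  have : ∀ s : Finset ι, ∏ j ∈ s, a ^ e j = a ^ (∑ j ∈ s, e j) := by
    intro s
    induction s using Finset.cons_induction with
    | empty => simp
    | cons b s hb ih => rw [Finset.prod_cons, Finset.sum_cons, ih, ENNReal.rpow_add _ _ ha ha']
  exact this _

lemma geoC_ne_top (hd : 1 ≤ d) [Fintype ι] (e : ι → ℝ) (he : 1 < ∑ j, e j) : geoC d e ≠ ∞ := by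
  set σ := ∑ j, e j
  have hσ0 : 0 ≤ σ := by linarith
  let ρ : ℝ≥0∞ := ((2⁻¹ : ℝ≥0∞) ^ d) ^ (σ - 1)
  have hρ : ρ < 1 := by
    refine ENNReal.rpow_lt_one ?_ (by linarith)
    exact pow_lt_one₀ (by simp) (by simp) (by omega)
  have hterm : ∀ k : ℕ, (∏ j, ((3 * 2⁻¹ ^ k : ℝ≥0∞) ^ d) ^ e j) * (3 * 2 ^ k) ^ d
      = (((3:ℝ≥0∞) ^ d) ^ σ * 3 ^ d) * ρ ^ k := by
    intro k
    have h2 : ((2⁻¹ : ℝ≥0∞) ^ k) ^ d ≠ 0 := by simp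
    have h2t : ((2⁻¹ : ℝ≥0∞) ^ k) ^ d ≠ ∞ := by simp
    have hinv : ((2:ℝ≥0∞) ^ k) ^ d = ((2⁻¹ ^ k) ^ d) ^ (-1 : ℝ) := by
      rw [ENNReal.rpow_neg_one, ← ENNReal.inv_pow, ← ENNReal.inv_pow, inv_inv]
    rw [prod_rpow_eq _ (by simp) (by simp [ENNReal.mul_eq_top]), mul_pow,
      ENNReal.mul_rpow_of_nonneg _ _ hσ0, mul_pow, hinv]
    have : ρ ^ k = (((2⁻¹ : ℝ≥0∞) ^ k) ^ d) ^ (σ - 1) := by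
      simp only [ρ]
      rw [← ENNReal.rpow_natCast, ← ENNReal.rpow_mul, mul_comm, ENNReal.rpow_mul, ENNReal.rpow_natCast,
        ← pow_mul, mul_comm, pow_mul]
    rw [this, sub_eq_add_neg, ENNReal.rpow_add _ _ h2 h2t]
    ring
  simp only [geoC, hterm]
  rw [ENNReal.tsum_mul_left, ENNReal.tsum_geometric]
  refine ENNReal.mul_ne_top (ENNReal.mul_ne_top ?_ (by simp)) ?_
  · exact ENNReal.rpow_ne_top_of_nonneg hσ0 (by simp)
  · rw [ENNReal.inv_ne_top]
    exact (tsub_pos_of_lt hρ).ne'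

lemma geo [Fintype ι] [Nonempty ι] (D : DGrid d) {e : ι → ℝ} (he : ∀ j, 0 < e j)
    (G : ι → (Fin d → ℝ) → ℝ≥0∞) (hG : ∀ j, ∀ x ∉ (D.cell 0 0).set, G j x = 0)
    {S : Set (Cube d)} (hS : IsSparse S) :
    ∑' Q : S, (∏ j, mean (G j) Q ^ e j) * (Q : Cube d).vol ≤
      2 * ((∏ j : ι, ((6:ℝ≥0∞) ^ d) ^ e j) + geoC d e) * ∑ α, ∫⁻ x, (D.shift α).mx e G x := by
  set P := ∏ j, mean (G j) (D.cell 0 0) ^ e j with hP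
  set A := ∏ j : ι, ((6:ℝ≥0∞) ^ d) ^ e j with hA
  let Φ1 : (Fin d → ℝ) → ℝ≥0∞ := fun x => A * ∑ α, (D.shift α).mx e G x
  let bt : ℕ → (Fin d → ℝ) → ℝ≥0∞ := fun k => (D.box k).set.indicator (fun _ =>
      (∏ j, ((3 * 2⁻¹ ^ k : ℝ≥0∞) ^ d) ^ e j) * P)
  let Φ2 : (Fin d → ℝ) → ℝ≥0∞ := fun x => ∑' k, bt k x
  have hm : Measurable fun x => ∑ α, (D.shift α).mx e G x :=
    Finset.measurable_fun_sum _ fun α _ => (D.shift α).measurable_mx e G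
  have h1 := sparse_sum_le hS (fun Q => ∏ j, mean (G j) Q ^ e j) (fun x => Φ1 x + Φ2 x) (by
    intro Q _ x hx
    rcases lt_or_ge Q.side (D.len / 3) with hQ | hQ
    · obtain ⟨α, hα⟩ := D.small_cube he G Q hQ x hx
      refine hα.trans (le_trans ?_ (le_add_of_nonneg_right zero_le))
      refine mul_le_mul_right ?_ A
      exact Finset.single_le_sum (f := fun α => (D.shift α).mx e G x) (fun _ _ => zero_le) (Finset.mem_univ α)
    · obtain ⟨k, hk⟩ := D.big_cube he G hG Q hQ x hx
      exact hk.trans ((ENNReal.le_tsum (f := fun k => bt k x) k).trans (le_add_of_nonneg_left zero_le)))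
  have hPle : P * (D.cell 0 0).vol ≤ ∑ α, ∫⁻ x, (D.shift α).mx e G x := by
    calc P * (D.cell 0 0).vol = ∫⁻ x in (D.cell 0 0).set, P := by rw [setLIntegral_const]; rfl
      _ ≤ ∫⁻ x in (D.cell 0 0).set, D.mx e G x := by
        refine setLIntegral_mono (D.measurable_mx e G) fun x hx => ?_
        rw [mem_cell] at hx
        refine le_trans (le_of_eq ?_) (le_iSup _ 0)
        simp only [avgOp, hx, hP]
      _ ≤ ∫⁻ x, D.mx e G x := setLIntegral_le_lintegral _ _
      _ = ∫⁻ x, (D.shift (fun _ => false)).mx e G x := by rw [shift_false]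
      _ ≤ _ := Finset.single_le_sum (f := fun α => ∫⁻ x, (D.shift α).mx e G x)
        (fun _ _ => zero_le) (Finset.mem_univ _)
  have hvol : ∀ k, (D.box k).vol = (3 * 2 ^ k) ^ d * (D.cell 0 0).vol := by
    intro k
    rw [Cube.vol_eq, Cube.vol_eq, ← mul_pow]
    congr 1
    simp only [box, cell]
    rw [ENNReal.ofReal_mul (by positivity), ENNReal.ofReal_mul (by norm_num),
      ENNReal.ofReal_pow (by norm_num)]
    simp
  refine h1.trans ?_
  rw [mul_assoc]
  gcongr 2 * ?_
  rw [lintegral_add_left (hm.const_mul A), lintegral_const_mul _ hm,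
    lintegral_finsetSum _ fun α _ => (D.shift α).measurable_mx e G, add_mul]
  refine add_le_add le_rfl ?_
  calc ∫⁻ x, Φ2 x = ∑' k, ∫⁻ x, bt k x :=
        lintegral_tsum fun k => (measurable_const.indicator (D.box k).meas).aemeasurable
    _ = ∑' k : ℕ, (∏ j, ((3 * 2⁻¹ ^ k : ℝ≥0∞) ^ d) ^ e j) * (3 * 2 ^ k) ^ d * (P * (D.cell 0 0).vol) := by
        refine tsum_congr fun k => ?_
        simp only [bt]
        rw [lintegral_indicator (D.box k).meas, setLIntegral_const]
        change _ * (D.box k).vol = _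
        rw [hvol]; ring
    _ = geoC d e * (P * (D.cell 0 0).vol) := ENNReal.tsum_mul_right
    _ ≤ _ := by gcongr

end DGrid

/-- the sparse form -/
def spForm {d : ℕ} {ι : Type*} [Fintype ι] (e : ι → ℝ) (h : ι → (Fin d → ℝ) → ℝ≥0∞)
    (S : Set (Cube d)) : ℝ≥0∞ :=
  ∑' Q : S, (∏ j, mean (h j) Q ^ e j) * (Q : Cube d).vol

def coreC (d : ℕ) {ι : Type*} [Fintype ι] (u e : ι → ℝ) : ℝ≥0∞ :=
  ∏ j, (ENNReal.ofReal (1/(1-u j)) * (2 ^ d * (2 * Fintype.card ι))) ^ e j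

def vecC (d : ℕ) {ι : Type*} [Fintype ι] (u e : ι → ℝ) : ℝ≥0∞ :=
  2 * ((∏ j : ι, ((6:ℝ≥0∞) ^ d) ^ e j) + DGrid.geoC d e) * (2 ^ d * coreC d u e)

lemma vecC_ne_top {d : ℕ} (hd : 1 ≤ d) {ι : Type*} [Fintype ι] {u e : ι → ℝ}
    (he : ∀ j, 0 < e j) (hs : 1 < ∑ j, e j) : vecC d u e ≠ ∞ := by
  have h1 : (∏ j : ι, ((6:ℝ≥0∞) ^ d) ^ e j) ≠ ∞ :=
    ENNReal.prod_ne_top fun j _ => ENNReal.rpow_ne_top_of_nonneg (he j).le (by simp)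
  have h2 : coreC d u e ≠ ∞ :=
    ENNReal.prod_ne_top fun j _ => ENNReal.rpow_ne_top_of_nonneg (he j).le
      (ENNReal.mul_ne_top (by simp) (by simp [ENNReal.mul_eq_top]))
  have h3 := DGrid.geoC_ne_top hd e hs
  exact ENNReal.mul_ne_top (ENNReal.mul_ne_top (by simp) (ENNReal.add_ne_top.2 ⟨h1, h3⟩))
    (ENNReal.mul_ne_top (by simp) h2)

lemma choose_S {d : ℕ} {ι : Type*} [Fintype ι] [Nonempty ι] (D : DGrid d) (e : ι → ℝ)
    (h : ι → (Fin d → ℝ) → ℝ≥0∞) (hm : ∀ j, Measurable (h j)) :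
    ∃ S : Set (Cube d), IsSparse S ∧
      ∀ α, spForm e h ((D.shift α).prinSet h (2 * Fintype.card ι)) ≤ spForm e h S := by
  obtain ⟨α, -, hα⟩ := Finset.exists_max_image (Finset.univ : Finset (Fin d → Bool))
    (fun α => spForm e h ((D.shift α).prinSet h (2 * Fintype.card ι))) ⟨fun _ => false, Finset.mem_univ _⟩
  exact ⟨_, (D.shift α).isSparse_prinSet h hm, fun β => hα β (Finset.mem_univ _)⟩

lemma vec {d : ℕ} {ι Ω : Type*} [MeasurableSpace Ω] [Fintype ι] [Nonempty ι] (D : DGrid d)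
    (h : ι → (Fin d → ℝ) → ℝ≥0∞) (hm : ∀ j, Measurable (h j))
    (μ : Measure Ω) [SigmaFinite μ] {u e : ι → ℝ} (hu0 : ∀ j, 0 ≤ u j) (hu1 : ∀ j, u j < 1)
    (he : ∀ j, 0 < e j) (hue : ∑ j, u j * e j = 1)
    (S : Set (Cube d))
    (hS : ∀ α, spForm e h ((D.shift α).prinSet h (2 * Fintype.card ι)) ≤ spForm e h S)
    (G : ι → (Fin d → ℝ) → Ω → ℝ≥0∞) (hG : ∀ j, Measurable (Function.uncurry (G j)))
    (hG0 : ∀ j, ∀ x ∉ (D.cell 0 0).set, ∀ ω, G j x ω = 0)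
    (hg : ∀ j, DGrid.VDom μ (u j) (G j) (h j)) :
    ∃ Ψ : Ω → ℝ≥0∞, Measurable Ψ ∧
      (∀ ω, ∀ S' : Set (Cube d), IsSparse S' → spForm e (fun j y => G j y ω) S' ≤ Ψ ω) ∧
      ∫⁻ ω, Ψ ω ∂μ ≤ vecC d u e * spForm e h S := by
  have hcard : (1:ℝ≥0∞) ≤ 2 * Fintype.card ι := by
    have : 1 ≤ Fintype.card ι := Fintype.card_pos
    have h1 : (1:ℝ≥0∞) ≤ Fintype.card ι := by exact_mod_cast this
    calc (1:ℝ≥0∞) ≤ Fintype.card ι := h1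
      _ = 1 * Fintype.card ι := by simp
      _ ≤ _ := by gcongr; norm_num
  set K := 2 * ((∏ j : ι, ((6:ℝ≥0∞) ^ d) ^ e j) + DGrid.geoC d e) with hK
  let W : (Fin d → Bool) → (Fin d → ℝ) × Ω → ℝ≥0∞ := fun α z =>
    (D.shift α).mx e (fun j y => G j y z.2) z.1
  have hW : ∀ α, Measurable (W α) := fun α =>
    Measurable.iSup fun k => Finset.measurable_fun_prod _ fun j _ =>
      ((D.shift α).measurable_avgOp_prod k (G j) (hG j)).pow_const _
  have hWi : ∀ α, Measurable fun ω => ∫⁻ x, W α (x, ω) := fun α => (hW α).lintegral_prod_left'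
  refine ⟨fun ω => K * ∑ α, ∫⁻ x, W α (x, ω), ?_, ?_, ?_⟩
  · exact (Finset.measurable_fun_sum _ fun α _ => hWi α).const_mul K
  · intro ω S' hS'
    exact D.geo he (fun j y => G j y ω) (fun j x hx => hG0 j x hx ω) hS'
  · rw [lintegral_const_mul _ (Finset.measurable_fun_sum _ fun α _ => hWi α),
      lintegral_finsetSum _ fun α _ => hWi α, vecC, ← hK, mul_assoc K]
    refine mul_le_mul_right ?_ K
    calc ∑ α, ∫⁻ ω, ∫⁻ x, W α (x, ω) ∂volume ∂μ
        ≤ ∑ α : Fin d → Bool, coreC d u e * spForm e h S := by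
          refine Finset.sum_le_sum fun α _ => ?_
          rw [← lintegral_prod_symm' _ (hW α)]
          refine ((D.shift α).core h (2 * Fintype.card ι) hcard hm μ hu0 hu1 he hue G hG hg).trans ?_
          exact mul_le_mul_right (hS α) _
      _ = _ := by
          rw [Finset.sum_const, Finset.card_univ]
          simp [mul_assoc]

lemma DGrid.VDom.rpow {d : ℕ} {Ω : Type*} [MeasurableSpace Ω] {μ : Measure Ω} {w : ℝ}
    {F : (Fin d → ℝ) → Ω → ℝ≥0∞} {H : (Fin d → ℝ) → ℝ≥0∞} (h : DGrid.VDom μ w F H)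
    {r : ℝ} (hr : 0 < r) : DGrid.VDom μ (r * w) (fun y ω => F y ω ^ r) (fun y => H y ^ r) := by
  unfold DGrid.VDom at *
  by_cases hw : w = 0
  · simp only [hw, mul_zero, if_true] at h ⊢
    intro y
    filter_upwards [h y] with ω hω
    exact ENNReal.rpow_le_rpow hω hr.le
  · have hrw : r * w ≠ 0 := mul_ne_zero hr.ne' hw
    simp only [hw, hrw, if_false] at h ⊢
    intro y
    have he : r * (1 / (r * w)) = 1 / w := by field_simp
    simp only [← ENNReal.rpow_mul, he]
    exact h y

lemma DGrid.VDom.mul {d : ℕ} {Ω : Type*} [MeasurableSpace Ω] {μ : Measure Ω} {w : ℝ} (hw0 : 0 ≤ w)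
    {k : (Fin d → ℝ) → Ω → ℝ≥0∞} (hk : Measurable (Function.uncurry k))
    (g : (Fin d → ℝ) → ℝ≥0∞) (h : DGrid.VDom μ w k (fun _ => 1)) :
    DGrid.VDom μ w (fun y ω => g y * k y ω) g := by
  unfold DGrid.VDom at *
  by_cases hw : w = 0
  · simp only [hw, if_true] at h ⊢
    intro y
    filter_upwards [h y] with ω hω
    calc g y * k y ω ≤ g y * 1 := by gcongr
      _ = g y := mul_one _
  · simp only [hw, if_false, ENNReal.one_rpow] at h ⊢
    intro y
    have hw' : 0 ≤ 1 / w := by positivity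
    simp only [ENNReal.mul_rpow_of_nonneg _ _ hw']
    have hkm : Measurable fun ω => k y ω ^ (1/w) := (hk.comp measurable_prodMk_left).pow_const _
    rw [lintegral_const_mul _ hkm]
    calc _ ≤ g y ^ (1/w) * 1 := by gcongr; exact h y
      _ = _ := mul_one _

/-- duality with bounded truncations -/
lemma dual {d : ℕ} {Ω : Type*} [MeasurableSpace Ω] (μ : Measure Ω) [SigmaFinite μ] {t : ℝ}
    (ht : 1 ≤ t) (U : (Fin d → ℝ) → Ω → ℝ≥0∞) (hU : Measurable (Function.uncurry U))
    (g : (Fin d → ℝ) → ℝ≥0∞) (hg : Measurable g) (K : ℝ≥0∞)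
    (H : ∀ k : (Fin d → ℝ) → Ω → ℝ≥0∞, Measurable (Function.uncurry k) →
      (∃ B, B ≠ ∞ ∧ ∀ x ω, k x ω ≤ B) → DGrid.VDom μ (1 - 1/t) k (fun _ => 1) →
      ∫⁻ x, (∫⁻ ω, U x ω * k x ω ∂μ) * g x ≤ K) :
    ∫⁻ x, (∫⁻ ω, U x ω ^ t ∂μ) ^ (1/t) * g x ≤ K := by
  classical
  have ht0 : 0 < t := by linarith
  let v : ℕ → (Fin d → ℝ) → Ω → ℝ≥0∞ := fun n x ω =>
    (spanningSets μ n).indicator (fun ω => min (U x ω) n) ω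
  have hv : ∀ n, Measurable (Function.uncurry (v n)) := by
    intro n
    have : Function.uncurry (v n) = (Prod.snd ⁻¹' (spanningSets μ n)).indicator
        (fun z : (Fin d → ℝ) × Ω => min (Function.uncurry U z) n) := by
      funext z
      simp only [v, Function.uncurry, Set.indicator, Set.mem_preimage]
    rw [this]
    exact (hU.min measurable_const).indicator (measurable_snd (measurableSet_spanningSets μ n))
  have hvU : ∀ n x ω, v n x ω ≤ U x ω := by
    intro n x ω
    simp only [v, Set.indicator]
    split_ifs
    · exact min_le_left _ _
    · exact zero_le
  have hvn : ∀ n x ω, v n x ω ≤ n := by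
    intro n x ω
    simp only [v, Set.indicator]
    split_ifs
    · exact min_le_right _ _
    · exact zero_le
  have hvmono : ∀ x ω, Monotone fun n => v n x ω := by
    intro x ω a b hab
    simp only [v, Set.indicator]
    by_cases ha : ω ∈ spanningSets μ a
    · rw [if_pos ha, if_pos (monotone_spanningSets μ hab ha)]
      gcongr
    · rw [if_neg ha]; exact zero_le
  have hvsup : ∀ x ω, ⨆ n, v n x ω = U x ω := by
    intro x ω
    refine le_antisymm (iSup_le fun n => hvU n x ω) ?_
    obtain ⟨n0, hn0⟩ : ∃ n, ω ∈ spanningSets μ n := by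
      have : ω ∈ ⋃ n, spanningSets μ n := by rw [iUnion_spanningSets]; trivial
      exact Set.mem_iUnion.1 this
    refine le_of_forall_lt fun c hc => ?_
    obtain ⟨n1, hn1⟩ := ENNReal.exists_nat_gt (ne_top_of_lt hc)
    refine lt_of_lt_of_le ?_ (le_iSup _ (max n0 n1))
    simp only [v]
    rw [Set.indicator_of_mem (monotone_spanningSets μ (le_max_left _ _) hn0)]
    refine lt_min hc (hn1.trans_le ?_)
    exact_mod_cast le_max_right n0 n1
  have hvt : ∀ n x, Measurable fun ω => v n x ω ^ t := fun n x =>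
    ((hv n).comp measurable_prodMk_left).pow_const t
  let I : ℕ → (Fin d → ℝ) → ℝ≥0∞ := fun n x => ∫⁻ ω, v n x ω ^ t ∂μ
  have hI : ∀ n, Measurable (I n) := fun n => ((hv n).pow_const t).lintegral_prod_right'
  have hImono : ∀ x, Monotone fun n => I n x := fun x a b hab =>
    lintegral_mono fun ω => ENNReal.rpow_le_rpow (hvmono x ω hab) ht0.le
  have hIt : ∀ n x, I n x ≠ ∞ := by
    intro n x
    have : I n x ≤ ∫⁻ ω in spanningSets μ n, (n:ℝ≥0∞) ^ t ∂μ := by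
      rw [← lintegral_indicator (measurableSet_spanningSets μ n)]
      refine lintegral_mono fun ω => ?_
      by_cases hω : ω ∈ spanningSets μ n
      · rw [Set.indicator_of_mem hω]
        exact ENNReal.rpow_le_rpow (hvn n x ω) ht0.le
      · have : v n x ω = 0 := by simp only [v]; rw [Set.indicator_of_notMem hω]
        rw [this, ENNReal.zero_rpow_of_pos ht0]; exact zero_le
    refine ne_top_of_le_ne_top ?_ this
    rw [setLIntegral_const]
    exact ENNReal.mul_ne_top (ENNReal.rpow_ne_top_of_nonneg ht0.le (by simp))
      (measure_spanningSets_lt_top μ n).ne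
  have hIsup : ∀ x, ⨆ n, I n x = ∫⁻ ω, U x ω ^ t ∂μ := by
    intro x
    simp only [I]
    rw [← lintegral_iSup (fun n => hvt n x)
      (fun a b hab ω => ENNReal.rpow_le_rpow (hvmono x ω hab) ht0.le)]
    refine lintegral_congr fun ω => ?_
    rw [← hvsup x ω]
    exact ((ENNReal.orderIsoRpow t ht0).map_iSup _).symm
  let X : ℕ → Set (Fin d → ℝ) := fun n => {x | ((n:ℝ≥0∞))⁻¹ ≤ I n x}
  have hX : ∀ n, MeasurableSet (X n) := fun n => measurableSet_le measurable_const (hI n)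
  let k : ℕ → (Fin d → ℝ) → Ω → ℝ≥0∞ := fun n x ω =>
    (X n).indicator (fun x => v n x ω ^ (t-1) * I n x ^ (-((t-1)/t))) x
  have hk : ∀ n, Measurable (Function.uncurry (k n)) := by
    intro n
    have : Function.uncurry (k n) = (Prod.fst ⁻¹' (X n)).indicator
        (fun z : (Fin d → ℝ) × Ω => Function.uncurry (v n) z ^ (t-1) * I n z.1 ^ (-((t-1)/t))) := by
      funext z
      simp only [k, Function.uncurry, Set.indicator, Set.mem_preimage]
    rw [this]
    exact (((hv n).pow_const _).mul (((hI n).comp measurable_fst).pow_const _)).indicator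
      (measurable_fst (hX n))
  have ht1 : 0 ≤ t - 1 := by linarith
  have htt : 0 ≤ (t-1)/t := by positivity
  have hkB : ∀ n, ∃ B, B ≠ ∞ ∧ ∀ x ω, k n x ω ≤ B := by
    intro n
    refine ⟨(n:ℝ≥0∞) ^ (t-1) * (n:ℝ≥0∞) ^ ((t-1)/t), ?_, ?_⟩
    · exact ENNReal.mul_ne_top (ENNReal.rpow_ne_top_of_nonneg ht1 (by simp))
        (ENNReal.rpow_ne_top_of_nonneg htt (by simp))
    · intro x ω
      by_cases hx : x ∈ X n
      · simp only [k]
        rw [Set.indicator_of_mem hx]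
        gcongr
        · exact hvn n x ω
        · rw [ENNReal.rpow_neg, ← ENNReal.inv_rpow]
          refine ENNReal.rpow_le_rpow ?_ htt
          exact ENNReal.inv_le_iff_inv_le.1 hx
      · simp only [k]
        rw [Set.indicator_of_notMem hx]; exact zero_le
  have hI0 : ∀ n, ∀ x ∈ X n, I n x ≠ 0 := by
    intro n x hx h0
    have hx' : (n:ℝ≥0∞)⁻¹ ≤ I n x := hx
    rw [h0] at hx'
    simp at hx'
  have hkD : ∀ n, DGrid.VDom μ (1 - 1/t) (k n) (fun _ => 1) := by
    intro n
    unfold DGrid.VDom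
    split_ifs with h1
    · have ht1 : t = 1 := by
        field_simp at h1; linarith
      intro x
      refine Filter.Eventually.of_forall fun ω => ?_
      simp only [k, Set.indicator]
      split_ifs
      · simp [ht1]
      · exact zero_le
    · have htne : t - 1 ≠ 0 := fun h => h1 (by field_simp; rw [h, mul_zero])
      have htp : 0 < t - 1 := lt_of_le_of_ne ht1 (Ne.symm htne)
      have hex : 1 / (1 - 1/t) = t / (t-1) := by field_simp
      rw [hex]
      intro x
      by_cases hx : x ∈ X n
      · have : ∀ ω, k n x ω ^ (t/(t-1)) = v n x ω ^ t * (I n x)⁻¹ := by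
          intro ω
          simp only [k]
          rw [Set.indicator_of_mem hx, ENNReal.mul_rpow_of_nonneg _ _ (by positivity),
            ← ENNReal.rpow_mul, ← ENNReal.rpow_mul, ← ENNReal.rpow_neg_one (I n x)]
          congr 2 <;> field_simp
        simp only [this]
        rw [lintegral_mul_const' _ _ (by simpa using hI0 n x hx)]
        change I n x * (I n x)⁻¹ ≤ _
        rw [ENNReal.mul_inv_cancel (hI0 n x hx) (hIt n x)]
        simp
      · have : ∀ ω, k n x ω = 0 := by
          intro ω; simp only [k]; rw [Set.indicator_of_notMem hx]
        have hpos : 0 < t/(t-1) := by positivity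
        simp [this, ENNReal.zero_rpow_of_pos hpos]
  let Nn : ℕ → (Fin d → ℝ) → ℝ≥0∞ := fun n => (X n).indicator (fun x => I n x ^ (1/t))
  have hNm : ∀ n, Measurable (Nn n) := fun n => ((hI n).pow_const _).indicator (hX n)
  have hNle : ∀ n x, Nn n x ≤ ∫⁻ ω, U x ω * k n x ω ∂μ := by
    intro n x
    by_cases hx : x ∈ X n
    · simp only [Nn]
      rw [Set.indicator_of_mem hx]
      calc I n x ^ (1/t) = I n x * I n x ^ (-((t-1)/t)) := by
            conv_rhs => rw [← ENNReal.rpow_one (I n x), ← ENNReal.rpow_mul, one_mul]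
            rw [← ENNReal.rpow_add _ _ (hI0 n x hx) (hIt n x)]
            congr 1; field_simp; ring
        _ = ∫⁻ ω, v n x ω ^ t * I n x ^ (-((t-1)/t)) ∂μ := by
            rw [lintegral_mul_const _ (hvt n x)]
        _ ≤ _ := by
            refine lintegral_mono fun ω => ?_
            simp only [k]
            rw [Set.indicator_of_mem hx, ← mul_assoc]
            gcongr ?_ * _
            calc v n x ω ^ t = v n x ω ^ (1 + (t-1)) := by congr 1; ring
              _ = v n x ω * v n x ω ^ (t-1) := by
                rw [ENNReal.rpow_add_of_nonneg _ _ zero_le_one ht1, ENNReal.rpow_one]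
              _ ≤ _ := by gcongr; exact hvU n x ω
    · simp only [Nn]
      rw [Set.indicator_of_notMem hx]; exact zero_le
  have hXmono : ∀ a b, a ≤ b → X a ⊆ X b := by
    intro a b hab x hx
    have hx' : (a:ℝ≥0∞)⁻¹ ≤ I a x := hx
    refine le_trans ?_ (hx'.trans (hImono x hab))
    exact ENNReal.inv_le_inv.2 (by exact_mod_cast hab)
  have hNmono : Monotone Nn := by
    intro a b hab x
    simp only [Nn]
    by_cases hx : x ∈ X a
    · rw [Set.indicator_of_mem hx, Set.indicator_of_mem (hXmono a b hab hx)]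
      exact ENNReal.rpow_le_rpow (hImono x hab) (by positivity)
    · rw [Set.indicator_of_notMem hx]; exact zero_le
  have hNsup : ∀ x, (∫⁻ ω, U x ω ^ t ∂μ) ^ (1/t) ≤ ⨆ n, Nn n x := by
    intro x
    rw [← hIsup x]
    have : (⨆ n, I n x) ^ (1/t) = ⨆ n, I n x ^ (1/t) :=
      (ENNReal.orderIsoRpow (1/t) (by positivity)).map_iSup _
    rw [this]
    refine iSup_le fun n0 => ?_
    by_cases h0 : I n0 x = 0
    · rw [h0, ENNReal.zero_rpow_of_pos (by positivity)]; exact zero_le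
    obtain ⟨n1, hn1⟩ := ENNReal.exists_nat_gt (ENNReal.inv_ne_top.2 h0)
    have hx : x ∈ X (max n0 n1) := by
      change ((max n0 n1 : ℕ) : ℝ≥0∞)⁻¹ ≤ I (max n0 n1) x
      refine le_trans ?_ (hImono x (le_max_left n0 n1))
      rw [ENNReal.inv_le_iff_inv_le]
      refine hn1.le.trans ?_
      exact_mod_cast le_max_right n0 n1
    refine le_trans ?_ (le_iSup _ (max n0 n1))
    simp only [Nn]
    rw [Set.indicator_of_mem hx]
    exact ENNReal.rpow_le_rpow (hImono x (le_max_left n0 n1)) (by positivity)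
  calc ∫⁻ x, (∫⁻ ω, U x ω ^ t ∂μ) ^ (1/t) * g x
      ≤ ∫⁻ x, ⨆ n, Nn n x * g x := by
        refine lintegral_mono fun x => ?_
        rw [← ENNReal.iSup_mul]
        exact mul_le_mul_left (hNsup x) _
    _ = ⨆ n, ∫⁻ x, Nn n x * g x :=
        lintegral_iSup (fun n => (hNm n).mul hg) (fun a b hab x => mul_le_mul_left (hNmono hab x) _)
    _ ≤ K := by
        refine iSup_le fun n => le_trans (lintegral_mono fun x => ?_) (H (k n) (hk n) (hkB n) (hkD n))
        exact mul_le_mul_left (hNle n x) _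

lemma VecSimple.measurable {d : ℕ} {Ω : Type*} [MeasurableSpace Ω] {f : (Fin d → ℝ) → Ω → ℂ}
    (hf : VecSimple f) : Measurable (Function.uncurry f) := by
  obtain ⟨N, A, ξ, hA, hb, hξ, hM, hf⟩ := hf
  have : Function.uncurry f = fun z : (Fin d → ℝ) × Ω =>
      ∑ i, (Prod.fst ⁻¹' (A i)).indicator (fun z : (Fin d → ℝ) × Ω => ξ i z.2) z := by
    funext z
    simp only [Function.uncurry, hf, Set.indicator, Set.mem_preimage]
    rfl
  rw [this]
  exact Finset.measurable_fun_sum _ fun i _ =>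
    ((hξ i).comp measurable_snd).indicator (measurable_fst (hA i))

lemma VecSimple.bound {d : ℕ} {Ω : Type*} [MeasurableSpace Ω] {f : (Fin d → ℝ) → Ω → ℂ}
    (hf : VecSimple f) : ∃ M : ℝ, ∀ x ω, ‖f x ω‖ ≤ M := by
  obtain ⟨N, A, ξ, hA, hb, hξ, ⟨M, hM⟩, hf⟩ := hf
  refine ⟨∑ i : Fin N, |M|, fun x ω => ?_⟩
  rw [hf]
  refine (norm_sum_le _ _).trans (Finset.sum_le_sum fun i _ => ?_)
  refine (norm_indicator_le_norm_self _ _).trans ((hM i ω).trans (le_abs_self M))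

lemma VecSimple.supp {d : ℕ} {Ω : Type*} [MeasurableSpace Ω] {f : (Fin d → ℝ) → Ω → ℂ}
    (hf : VecSimple f) : ∃ R : ℝ, ∀ x ω, f x ω ≠ 0 → ‖x‖ ≤ R := by
  obtain ⟨N, A, ξ, hA, hb, hξ, ⟨M, hM⟩, hf⟩ := hf
  have hB : Bornology.IsBounded (⋃ i, A i) := Bornology.isBounded_iUnion.2 hb
  obtain ⟨R, hR⟩ := hB.exists_norm_le
  refine ⟨R, fun x ω hx => hR x ?_⟩
  by_contra hx'
  apply hx
  rw [hf]
  refine Finset.sum_eq_zero fun i _ => ?_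
  rw [Set.indicator_of_notMem]
  exact fun h => hx' (Set.mem_iUnion.2 ⟨i, h⟩)

lemma VecSimple.measurable_eNorm {d : ℕ} {Ω : Type*} [MeasurableSpace Ω] {f : (Fin d → ℝ) → Ω → ℂ}
    (hf : VecSimple f) (μ : Measure Ω) (p : ℝ≥0∞) :
    Measurable fun x => eNorm p μ (nn (f x)) := by
  classical
  obtain ⟨N, A, ξ, hA, hb, hξ, ⟨M, hM⟩, hf⟩ := hf
  let φ : (Fin d → ℝ) → (Fin N → Bool) := fun x i => decide (x ∈ A i)
  have hφ : Measurable φ := by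
    refine measurable_pi_lambda _ fun i => ?_
    refine measurable_to_bool ?_
    have : (fun x => φ x i) ⁻¹' {true} = A i := by ext x; simp [φ]
    rw [this]; exact hA i
  let ψ : (Fin N → Bool) → ℝ≥0∞ := fun v => eNorm p μ (nn (fun ω => ∑ i, if v i then ξ i ω else 0))
  have : (fun x => eNorm p μ (nn (f x))) = ψ ∘ φ := by
    funext x
    simp only [Function.comp, ψ]
    congr 2
    funext ω
    rw [hf]
    simp [φ, Set.indicator]
  rw [this]
  exact (measurable_of_countable ψ).comp hφ

lemma VecSimple.memLinftyC {d : ℕ} {Ω : Type*} [MeasurableSpace Ω] {f : (Fin d → ℝ) → Ω → ℂ}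
    (hf : VecSimple f) (ω : Ω) : MemLinftyC (fun x => f x ω) := by
  refine ⟨hf.measurable.comp measurable_prodMk_right, ?_, ?_⟩
  · obtain ⟨M, hM⟩ := hf.bound
    exact ⟨M, fun x => hM x ω⟩
  · obtain ⟨R, hR⟩ := hf.supp
    exact isBounded_iff_forall_norm_le.2 ⟨R, fun x hx => hR x ω hx⟩

lemma vdom_eNorm {d : ℕ} {Ω : Type*} [MeasurableSpace Ω] (μ : Measure Ω) (f : (Fin d → ℝ) → Ω → ℂ)
    (t : ℝ≥0∞) (ht : t ≠ 0) :
    DGrid.VDom μ (t⁻¹).toReal (fun y => nn (f y)) (fun y => eNorm t μ (nn (f y))) := by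
  unfold DGrid.VDom eNorm
  by_cases htt : t = ∞
  · simp only [htt, ENNReal.inv_top, ENNReal.toReal_zero, if_true]
    exact fun y => ENNReal.ae_le_essSup _
  · have h0 : t.toReal ≠ 0 := ENNReal.toReal_ne_zero.2 ⟨ht, htt⟩
    simp only [ENNReal.toReal_inv, inv_eq_zero, h0, htt, if_false, one_div, inv_inv]
    intro y
    rw [← ENNReal.rpow_mul, inv_mul_cancel₀ h0, ENNReal.rpow_one]

lemma avg_eq_mean {d : ℕ} {r : ℝ≥0∞} (hr : r ≠ ∞) (F : (Fin d → ℝ) → ℝ≥0∞) (Q : Cube d) :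
    avg r F Q = mean (fun y => F y ^ r.toReal) Q ^ (1 / r.toReal) := by
  simp [avg, mean, hr]

/-- scalar-valued sparse-form domination of a multilinear operator
implies `L^t(Ω)`-valued sparse-form domination of its extension. -/
theorem statement15 (d m : ℕ) (hd : 1 ≤ d) (hm : 1 ≤ m)
    (r : Fin m → ℝ≥0∞) (hr : ∀ j, 0 < r j ∧ r j ≠ ∞)
    (s : ℝ≥0∞) (hs : 1 < s)
    (t : Fin m → ℝ≥0∞) (hrt : ∀ j, r j < t j)
    (ht1 : 1 ≤ (∑ j, (t j)⁻¹)⁻¹) (hts : (∑ j, (t j)⁻¹)⁻¹ < s)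
    (htfin : (∑ j, (t j)⁻¹)⁻¹ ≠ ∞) :
    ∃ C : ℝ≥0∞, 0 < C ∧ C ≠ ∞ ∧
      ∀ (Ω : Type) [MeasurableSpace Ω] (μ : Measure Ω) [SigmaFinite μ],
      ∀ (T : (Fin m → ((Fin d → ℝ) → ℂ)) → ((Fin d → ℝ) → ℂ)) (C_T : ℝ≥0∞),
        -- T maps tuples of functions in L^∞_c to measurable functions
        (∀ f, (∀ j, MemLinftyC (f j)) → Measurable (T f)) →
        -- scalar-valued sparse-form domination
        (∀ f g, (∀ j, MemLinftyC (f j)) → MemLinftyC g →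
          ∃ S : Set (Cube d), IsSparse S ∧
            ∫⁻ x, nn (T f) x * nn g x ≤
              C_T * ∑' Q : S, (∏ j, avg (r j) (nn (f j)) (Q : Cube d)) *
                avg (1 - s⁻¹)⁻¹ (nn g) (Q : Cube d) * (Q : Cube d).vol) →
        -- joint measurability of the extension on simple functions
        (∀ f : Fin m → (Fin d → ℝ) → Ω → ℂ, (∀ j, VecSimple (f j)) →
          Measurable (Function.uncurry fun x ω => T (fun j y => f j y ω) x)) →
        -- vector-valued sparse-form domination of the extension
        ∀ (f : Fin m → (Fin d → ℝ) → Ω → ℂ), (∀ j, VecSimple (f j)) →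
        ∀ (g : (Fin d → ℝ) → ℂ), MemLinftyC g →
          ∃ S : Set (Cube d), IsSparse S ∧
            ∫⁻ x, eNorm (∑ j, (t j)⁻¹)⁻¹ μ
                (fun ω => (‖T (fun j y => f j y ω) x‖₊ : ℝ≥0∞)) * nn g x ≤
              C * C_T * ∑' Q : S,
                (∏ j, avg (r j) (fun x => eNorm (t j) μ (nn (f j x))) (Q : Cube d)) *
                  avg (1 - s⁻¹)⁻¹ (nn g) (Q : Cube d) * (Q : Cube d).vol := by
  classical
  -- exponents
  have htj0 : ∀ j, t j ≠ 0 := fun j => ((hr j).1.trans (hrt j)).ne'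
  have hrj : ∀ j, 0 < (r j).toReal := fun j => ENNReal.toReal_pos (hr j).1.ne' (hr j).2
  set τ := (∑ j, (t j)⁻¹)⁻¹ with hτ
  have htr : 1 ≤ τ.toReal := by
    have := (ENNReal.toReal_le_toReal (by simp) htfin).2 ht1
    simpa using this
  have htr0 : 0 < τ.toReal := by linarith
  have hsumw : ∑ j, ((t j)⁻¹).toReal = 1 / τ.toReal := by
    rw [← ENNReal.toReal_sum fun j _ => ENNReal.inv_ne_top.2 (htj0 j), hτ, ENNReal.toReal_inv]
    simp
  set sp := (1 - s⁻¹)⁻¹ with hsp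
  have hs1 : s⁻¹ < 1 := ENNReal.inv_lt_one.2 hs
  have hspt : sp ≠ ∞ := ENNReal.inv_ne_top.2 (tsub_pos_of_lt hs1).ne'
  have hsi : s⁻¹.toReal < 1 := by
    have := (ENNReal.toReal_lt_toReal (ne_top_of_lt hs1) (by simp)).2 hs1
    simpa using this
  have hspr : sp.toReal = 1 / (1 - s⁻¹.toReal) := by
    rw [hsp, ENNReal.toReal_inv, ENNReal.toReal_sub_of_le hs1.le (by simp)]
    simp
  have hsp0 : 0 < sp.toReal := by
    rw [hspr]; have : 0 < 1 - s⁻¹.toReal := by linarith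
    positivity
  have hτs : s⁻¹.toReal < 1 / τ.toReal := by
    have h1 : s⁻¹ < τ⁻¹ := ENNReal.inv_lt_inv.2 hts
    have hτ0 : τ ≠ 0 := fun h => by rw [h] at ht1; simp at ht1
    have := (ENNReal.toReal_lt_toReal (ne_top_of_lt hs1) (ENNReal.inv_ne_top.2 hτ0)).2 h1
    rw [ENNReal.toReal_inv τ] at this
    simpa using this
  let rr : Option (Fin m) → ℝ := fun o => o.elim sp.toReal (fun j => (r j).toReal)
  let w : Option (Fin m) → ℝ := fun o => o.elim (1 - 1 / τ.toReal) (fun j => ((t j)⁻¹).toReal)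
  let e : Option (Fin m) → ℝ := fun o => 1 / rr o
  let u : Option (Fin m) → ℝ := fun o => rr o * w o
  have hrr : ∀ o, 0 < rr o := by
    rintro (_ | j)
    · exact hsp0
    · exact hrj j
  have he : ∀ o, 0 < e o := fun o => one_div_pos.2 (hrr o)
  have hw0 : ∀ o, 0 ≤ w o := by
    rintro (_ | j)
    · change 0 ≤ 1 - 1 / τ.toReal
      have : 1 / τ.toReal ≤ 1 := by rw [div_le_one htr0]; exact htr
      linarith
    · exact ENNReal.toReal_nonneg
  have hu0 : ∀ o, 0 ≤ u o := fun o => mul_nonneg (hrr o).le (hw0 o)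
  have hu1 : ∀ o, u o < 1 := by
    rintro (_ | j)
    · change sp.toReal * (1 - 1 / τ.toReal) < 1
      rw [hspr, one_div_mul_eq_div, div_lt_one (by linarith)]
      linarith
    · change (r j).toReal * ((t j)⁻¹).toReal < 1
      rw [← ENNReal.toReal_mul, ← div_eq_mul_inv]
      have h1 : r j / t j < 1 := by
        rw [ENNReal.div_lt_iff (Or.inl (htj0 j)) (Or.inr (hr j).2), one_mul]
        exact hrt j
      have := (ENNReal.toReal_lt_toReal (ne_top_of_lt h1) (by simp)).2 h1
      simpa using this
  have hueo : ∀ o, u o * e o = w o := by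
    intro o
    have := (hrr o).ne'
    simp only [u, e]; field_simp
  have hue : ∑ o, u o * e o = 1 := by
    simp only [hueo]
    rw [Fintype.sum_option]
    simp only [w, Option.elim]
    rw [hsumw]; ring
  have hes : 1 < ∑ o, e o := by
    rw [← hue]
    refine Finset.sum_lt_sum_of_nonempty Finset.univ_nonempty fun o _ => ?_
    have := mul_lt_mul_of_pos_right (hu1 o) (he o)
    linarith
  refine ⟨vecC d u e + 1, by simp, ENNReal.add_ne_top.2 ⟨vecC_ne_top hd he hes, by simp⟩, ?_⟩
  intro Ω _ μ _ T C_T hTm hsparse hjm f hf g hg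
  -- grid
  choose R hR using fun j => (hf j).supp
  obtain ⟨Rg, hRg⟩ := isBounded_iff_forall_norm_le.1 hg.2.2
  let R0 : ℝ := |Rg| + ∑ j, |R j|
  have hR0 : 0 ≤ R0 := add_nonneg (abs_nonneg _) (Finset.sum_nonneg fun j _ => abs_nonneg _)
  let D : DGrid d := ⟨fun _ => -(R0 + 1), 2 * (R0 + 1), by linarith⟩
  have hcell : ∀ x : Fin d → ℝ, ‖x‖ ≤ R0 → x ∈ (D.cell 0 0).set := by
    intro x hx i
    have h1 := (norm_le_pi_norm x i).trans hx
    rw [Real.norm_eq_abs, abs_le] at h1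
    simp only [DGrid.cell, D, pow_zero, div_one, Pi.zero_apply, Int.cast_zero, mul_zero, add_zero]
    constructor <;> linarith [h1.1, h1.2]
  have hf0 : ∀ j, ∀ x ∉ (D.cell 0 0).set, ∀ ω, f j x ω = 0 := by
    intro j x hx ω
    by_contra h
    refine hx (hcell x ((hR j x ω h).trans ((le_abs_self _).trans ?_)))
    have := Finset.single_le_sum (f := fun j => |R j|) (fun j _ => abs_nonneg _) (Finset.mem_univ j)
    have h2 := abs_nonneg Rg
    simp only [R0]; linarith
  have hg0 : ∀ x ∉ (D.cell 0 0).set, g x = 0 := by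
    intro x hx
    by_contra h
    refine hx (hcell x ((hRg x h).trans ((le_abs_self _).trans ?_)))
    have := Finset.sum_nonneg (s := Finset.univ) fun j (_ : j ∈ Finset.univ) => abs_nonneg (R j)
    simp only [R0]; linarith
  -- scalar majorants
  let H : Option (Fin m) → (Fin d → ℝ) → ℝ≥0∞ := fun o => o.elim (nn g)
    (fun j x => eNorm (t j) μ (nn (f j x)))
  have hnng : Measurable (nn g) := hg.1.nnnorm.coe_nnreal_ennreal
  have hH : ∀ o, Measurable (H o) := by
    rintro (_ | j)
    · exact hnng
    · exact (hf j).measurable_eNorm μ (t j)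
  let h : Option (Fin m) → (Fin d → ℝ) → ℝ≥0∞ := fun o x => H o x ^ rr o
  have hh : ∀ o, Measurable (h o) := fun o => (hH o).pow_const _
  obtain ⟨S, hSs, hS⟩ := choose_S D e h hh
  refine ⟨S, hSs, ?_⟩
  have hformS : ∑' Q : S, (∏ j, avg (r j) (fun x => eNorm (t j) μ (nn (f j x))) (Q : Cube d)) *
      avg sp (nn g) (Q : Cube d) * (Q : Cube d).vol = spForm e h S := by
    refine tsum_congr fun Q => ?_
    rw [Fintype.prod_option, mul_comm (mean _ _ ^ _)]
    simp only [avg_eq_mean hspt, avg_eq_mean (hr _).2]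
    rfl
  rw [hformS]
  simp only [eNorm, if_neg htfin]
  have hUm : Measurable (Function.uncurry fun x ω => (‖T (fun j y => f j y ω) x‖₊ : ℝ≥0∞)) :=
    (hjm f hf).nnnorm.coe_nnreal_ennreal
  refine dual μ htr (fun x ω => (‖T (fun j y => f j y ω) x‖₊ : ℝ≥0∞)) hUm (nn g) hnng _ ?_
  intro k hk hkB hkD
  obtain ⟨B, hB, hkB⟩ := hkB
  have hkt : ∀ x ω, k x ω ≠ ∞ := fun x ω => ne_top_of_le_ne_top hB (hkB x ω)
  let F : Option (Fin m) → (Fin d → ℝ) → Ω → ℝ≥0∞ := fun o => o.elim (fun x ω => nn g x * k x ω)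
    (fun j x => nn (f j x))
  let G : Option (Fin m) → (Fin d → ℝ) → Ω → ℝ≥0∞ := fun o x ω => F o x ω ^ rr o
  have hF : ∀ o, Measurable (Function.uncurry (F o)) := by
    rintro (_ | j)
    · exact (hnng.comp measurable_fst).mul hk
    · exact (hf j).measurable.nnnorm.coe_nnreal_ennreal
  have hG : ∀ o, Measurable (Function.uncurry (G o)) := fun o => (hF o).pow_const _
  have hF0 : ∀ o, ∀ x ∉ (D.cell 0 0).set, ∀ ω, F o x ω = 0 := by
    rintro (_ | j) x hx ω
    · simp [F, nn, hg0 x hx]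
    · simp [F, nn, hf0 j x hx ω]
  have hG0 : ∀ o, ∀ x ∉ (D.cell 0 0).set, ∀ ω, G o x ω = 0 := by
    intro o x hx ω
    simp only [G, hF0 o x hx ω, ENNReal.zero_rpow_of_pos (hrr o)]
  have hV : ∀ o, DGrid.VDom μ (u o) (G o) (h o) := by
    intro o
    refine DGrid.VDom.rpow ?_ (hrr o)
    rcases o with _ | j
    · exact DGrid.VDom.mul (hw0 none) hk (nn g) hkD
    · exact vdom_eNorm μ (f j) (t j) (htj0 j)
  obtain ⟨Ψ, hΨm, hΨ, hΨi⟩ := vec D h hh μ hu0 hu1 he hue S hS G hG hG0 hV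
  have hkslice : ∀ ω, Measurable fun x => k x ω := fun ω => hk.comp measurable_prodMk_right
  have hUslice : ∀ x, Measurable fun ω => (‖T (fun j y => f j y ω) x‖₊ : ℝ≥0∞) * k x ω := fun x =>
    (hUm.comp measurable_prodMk_left).mul (hk.comp measurable_prodMk_left)
  have hscal : ∀ ω, ∫⁻ x, (‖T (fun j y => f j y ω) x‖₊ : ℝ≥0∞) * k x ω * nn g x ≤ C_T * Ψ ω := by
    intro ω
    let gk : (Fin d → ℝ) → ℂ := fun x => g x * ((k x ω).toReal : ℂ)
    have hgk : MemLinftyC gk := by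
      refine ⟨hg.1.mul (Complex.measurable_ofReal.comp (hkslice ω).ennreal_toReal), ?_, ?_⟩
      · obtain ⟨M, hM⟩ := hg.2.1
        refine ⟨|M| * B.toReal, fun x => ?_⟩
        simp only [gk, norm_mul, Complex.norm_real, Real.norm_eq_abs, abs_of_nonneg ENNReal.toReal_nonneg]
        exact mul_le_mul ((hM x).trans (le_abs_self M)) (ENNReal.toReal_mono hB (hkB x ω))
          ENNReal.toReal_nonneg (abs_nonneg M)
      · refine hg.2.2.subset fun x hx => ?_
        exact left_ne_zero_of_mul hx
    have hnngk : nn gk = fun x => nn g x * k x ω := by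
      funext x
      simp only [nn, gk, nnnorm_mul, ENNReal.coe_mul]
      congr 1
      rw [← enorm_eq_nnnorm, ← ofReal_norm, Complex.norm_real, Real.norm_eq_abs,
        abs_of_nonneg ENNReal.toReal_nonneg, ENNReal.ofReal_toReal (hkt x ω)]
    obtain ⟨S', hS', hle⟩ := hsparse (fun j y => f j y ω) gk (fun j => (hf j).memLinftyC ω) hgk
    have hform : ∑' Q : S', (∏ j, avg (r j) (nn fun y => f j y ω) (Q : Cube d)) *
        avg sp (nn gk) (Q : Cube d) * (Q : Cube d).vol = spForm e (fun o y => G o y ω) S' := by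
      refine tsum_congr fun Q => ?_
      rw [Fintype.prod_option, mul_comm (mean _ _ ^ _)]
      simp only [avg_eq_mean hspt, avg_eq_mean (hr _).2, hnngk]
      rfl
    rw [hform] at hle
    calc _ = ∫⁻ x, nn (T fun j y => f j y ω) x * nn gk x := by
          refine lintegral_congr fun x => ?_
          rw [hnngk]
          simp only [nn]
          ring
      _ ≤ _ := hle
      _ ≤ _ := mul_le_mul_right (hΨ ω S' hS') _
  calc ∫⁻ x, (∫⁻ ω, (‖T (fun j y => f j y ω) x‖₊ : ℝ≥0∞) * k x ω ∂μ) * nn g x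
      = ∫⁻ x, ∫⁻ ω, (‖T (fun j y => f j y ω) x‖₊ : ℝ≥0∞) * k x ω * nn g x ∂μ := by
        refine lintegral_congr fun x => ?_
        rw [lintegral_mul_const _ (hUslice x)]
    _ = ∫⁻ ω, ∫⁻ x, (‖T (fun j y => f j y ω) x‖₊ : ℝ≥0∞) * k x ω * nn g x ∂volume ∂μ := by
        refine lintegral_lintegral_swap ?_
        exact ((hUm.mul hk).mul (hnng.comp measurable_fst)).aemeasurable
    _ ≤ ∫⁻ ω, C_T * Ψ ω ∂μ := lintegral_mono hscal
    _ = C_T * ∫⁻ ω, Ψ ω ∂μ := lintegral_const_mul _ hΨm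
    _ ≤ C_T * (vecC d u e * spForm e h S) := mul_le_mul_right hΨi _
    _ ≤ C_T * ((vecC d u e + 1) * spForm e h S) := by
        gcongr
        exact le_add_of_nonneg_right zero_le
    _ = _ := by ring

end
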